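/- arXiv:1911.03469 — 3 statements merged into one kernel-verified Lean document; each statement's English description precedes it below -/
import Mathlib

section
/- Let n ≥ 1, let U be an open neighborhood of the origin in ℂ^{n+1}, and let f : ℂ^{n+1} → ℂ be complex analytic on U. Then the restriction of f to its critical locus Σf := {z ∈ U : Df(z) = 0}, equipped with the subspace topology, is locally constant. In particular, for every p ∈ Σf there is an open neighborhood V ⊆ U of p such that every q ∈ V with Df(q) = 0 satisfies f(q) = f(p); hence if f(p) = 0 then Σf ∩ V ⊆ f⁻¹(0). -/
open Metric Set Filter Topology Asymptotics

theorem AnalyticOnNhd.exists_eq_sub_pow_mul {h : ℂ → ℂ} {s : Set ℂ} {z : ℂ}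
    (hh : AnalyticOnNhd ℂ h s) (hz : z ∈ s) (hne : ¬ ∀ᶠ w in 𝓝 z, h w = 0) :
    ∃ (m : ℕ) (u : ℂ → ℂ), AnalyticOnNhd ℂ u s ∧ u z ≠ 0 ∧ ∀ w, h w = (w - z) ^ m * u w := by
  obtain ⟨m, g, hg, hgz, hev⟩ :=
    (hh z hz).exists_eventuallyEq_pow_smul_nonzero_iff.2 hne
  simp only [smul_eq_mul] at hev
  have hu : Function.update (fun w => h w / (w - z) ^ m) z (g z) =ᶠ[𝓝 z] g := by
    filter_upwards [hev] with w hw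
    rcases eq_or_ne w z with rfl | hwz
    · simp
    · have : w - z ≠ 0 := sub_ne_zero.2 hwz
      simp only [Function.update_of_ne hwz, hw]
      field_simp
  refine ⟨m, Function.update (fun w => h w / (w - z) ^ m) z (g z), ?_, by simpa, ?_⟩
  · intro w hw
    rcases eq_or_ne w z with rfl | hwz
    · exact hg.congr hu.symm
    · have h1 : AnalyticAt ℂ (fun w => h w / (w - z) ^ m) w :=
        (hh w hw).fun_div (by fun_prop) (pow_ne_zero _ (sub_ne_zero.2 hwz))
      refine h1.congr ?_
      filter_upwards [isOpen_ne.mem_nhds hwz] with v hv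
      rw [Function.update_of_ne hv]
  · intro w
    rcases eq_or_ne w z with rfl | hwz
    · simpa using hev.self_of_nhds
    · have : w - z ≠ 0 := sub_ne_zero.2 hwz
      simp only [Function.update_of_ne hwz]
      field_simp

theorem AnalyticOnNhd.finite_zeros_closedBall {h : ℂ → ℂ} {c a : ℂ} {r : ℝ}
    (hh : AnalyticOnNhd ℂ h (closedBall c r)) (ha : a ∈ closedBall c r) (hne : h a ≠ 0) :
    {w | w ∈ closedBall c r ∧ h w = 0}.Finite := by
  by_contra hinf
  obtain ⟨w, hw, hacc⟩ := Set.Infinite.exists_accPt_of_subset_isCompact hinf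
    (isCompact_closedBall c r) (fun w hw => hw.1)
  refine hne (hh.eqOn_zero_of_preconnected_of_frequently_eq_zero
    (convex_closedBall c r).isPreconnected hw ?_ ha)
  exact (accPt_iff_frequently_nhdsNE.1 hacc).mono fun v hv => hv.2

/-- For `h` holomorphic near a closed disc and without zeros on its boundary circle, this is the sum
of the `k`-th powers of the zeros of `h` in the disc, counted with multiplicity. -/
noncomputable def zeroMoment (h : ℂ → ℂ) (c : ℂ) (r : ℝ) (k : ℕ) : ℂ :=
  (2 * Real.pi * Complex.I)⁻¹ * ∮ w in C(c, r), w ^ k * (deriv h w / h w)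

theorem exists_zeroMoment_eq_sum {c : ℂ} {r : ℝ} (hr : 0 < r) (Z : Finset ℂ) :
    ∀ h : ℂ → ℂ, AnalyticOnNhd ℂ h (closedBall c r) → (∀ w ∈ sphere c r, h w ≠ 0) →
      (∀ w, w ∈ Z ↔ w ∈ closedBall c r ∧ h w = 0) →
      ∃ m : ℂ → ℕ, (∀ z ∈ Z, 0 < m z) ∧
        ∀ k, zeroMoment h c r k = ∑ z ∈ Z, (m z : ℂ) * z ^ k := by
  classical
  induction Z using Finset.induction_on with
  | empty =>
    intro h hh hs hZ
    refine ⟨0, by simp, fun k => ?_⟩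
    have h0 : ∀ w ∈ closedBall c r, h w ≠ 0 := fun w hw h0 => by
      simpa using (hZ w).2 ⟨hw, h0⟩
    have : AnalyticOnNhd ℂ (fun w => w ^ k * (deriv h w / h w)) (closedBall c r) := fun w hw =>
      (by fun_prop : AnalyticAt ℂ (fun w : ℂ => w ^ k) w).fun_mul
        ((hh w hw).deriv.fun_div (hh w hw) (h0 w hw))
    rw [zeroMoment, Complex.circleIntegral_eq_zero_of_differentiable_on_off_countable hr.le
      countable_empty this.continuousOn
      fun w hw => (this w (ball_subset_closedBall hw.1)).differentiableAt]
    simp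
  | insert z Z hzZ ih =>
    intro h hh hs hZ
    have hz := (hZ z).1 (by simp)
    obtain ⟨a, ha⟩ : (sphere c r).Nonempty := NormedSpace.sphere_nonempty.2 hr.le
    have hne : ¬ ∀ᶠ w in 𝓝 z, h w = 0 := fun hev => hs a ha
      (hh.eqOn_zero_of_preconnected_of_eventuallyEq_zero (convex_closedBall c r).isPreconnected
        hz.1 hev (sphere_subset_closedBall ha))
    obtain ⟨n, u, hu, huz, hmul⟩ := hh.exists_eq_sub_pow_mul hz.1 hne
    have hn : n ≠ 0 := by
      rintro rfl
      exact huz (by simpa [hz.2] using (hmul z).symm)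
    have hus : ∀ w ∈ sphere c r, u w ≠ 0 := fun w hw h0 => hs w hw (by simp [hmul, h0])
    obtain ⟨m, hm, hsum⟩ := ih u hu hus (by
      intro w
      have := hZ w
      rw [Finset.mem_insert, hmul w, mul_eq_zero, pow_eq_zero_iff hn, sub_eq_zero] at this
      rcases eq_or_ne w z with rfl | hwz
      · simp [hzZ, huz]
      · simpa [hwz] using this)
    have hzb : z ∈ ball c r := by
      rcases (mem_closedBall.1 hz.1).lt_or_eq with hlt | heq
      · exact hlt
      · exact absurd hz.2 (hs z heq)
    refine ⟨Function.update m z n, ?_, fun k => ?_⟩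
    · intro w hw
      rcases eq_or_ne w z with rfl | hwz
      · simp; omega
      · rw [Function.update_of_ne hwz]
        exact hm w (by simpa [hwz] using hw)
    · rw [Finset.sum_insert hzZ, Function.update_self,
        Finset.sum_congr rfl (g := fun z => (m z : ℂ) * z ^ k)
        (fun w hw => by rw [Function.update_of_ne (ne_of_mem_of_not_mem hw hzZ)]), ← hsum k]
      have hsz : ∀ w ∈ sphere c r, w - z ≠ 0 := fun w hw e => by
        rw [sub_eq_zero] at e
        exact hs w hw (e ▸ hz.2)
      have hcongr : ∀ w ∈ sphere c r, w ^ k * (deriv h w / h w) =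
          n * ((w - z)⁻¹ • w ^ k) + w ^ k * (deriv u w / u w) := by
        intro w hw
        have hd : deriv h w = n * (w - z) ^ (n - 1) * u w + (w - z) ^ n * deriv u w := by
          rw [show h = (fun w => (w - z) ^ n) * u from funext hmul]
          have h1 : HasDerivAt (fun w => (w - z) ^ n) (n * (w - z) ^ (n - 1) * 1) w :=
            ((hasDerivAt_id w).sub_const z).pow n
          simpa using (h1.mul
            (hu w (sphere_subset_closedBall hw)).differentiableAt.hasDerivAt).deriv
        obtain ⟨n, rfl⟩ := Nat.exists_eq_succ_of_ne_zero hn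
        have h1 := hsz w hw
        have h2 := hus w hw
        rw [hd, hmul w, smul_eq_mul]
        simp only [Nat.succ_eq_add_one, Nat.add_sub_cancel]
        field_simp
        ring
      rw [zeroMoment, circleIntegral.integral_congr hr.le hcongr, circleIntegral.integral_add,
        circleIntegral.integral_const_mul,
        DifferentiableOn.circleIntegral_sub_inv_smul (f := fun w : ℂ => w ^ k) (by fun_prop) hzb,
        zeroMoment, mul_add]
      · have := Complex.two_pi_I_ne_zero
        simp only [smul_eq_mul]
        field_simp
      · refine ContinuousOn.circleIntegrable hr.le (fun w hw => ContinuousAt.continuousWithinAt ?_)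
        have := hsz w hw
        fun_prop (disch := assumption)
      · refine ContinuousOn.circleIntegrable hr.le (fun w hw => ContinuousAt.continuousWithinAt ?_)
        have h1 := hu w (sphere_subset_closedBall hw)
        exact (by fun_prop : ContinuousAt (fun w : ℂ => w ^ k) w).mul
          (h1.deriv.continuousAt.div h1.continuousAt (hus w hw))

theorem continuousAt_fderiv_of_eventually_differentiableAt {E : Type*} [NormedAddCommGroup E]
    [NormedSpace ℂ E] [ProperSpace E] {F : E → ℂ} {p : E}
    (hF : ∀ᶠ q in 𝓝 p, DifferentiableAt ℂ F q) : ContinuousAt (fderiv ℂ F) p := by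
  obtain ⟨r, hr, hball⟩ := Metric.eventually_nhds_iff_ball.1 hF
  have hr2 : 0 < r / 2 := by positivity
  have hr4 : 0 < r / 4 := by positivity
  rw [Metric.continuousAt_iff']
  intro ε hε
  have hclose : ∀ᶠ q in 𝓝 p, ∀ y ∈ closedBall p (r / 2),
      ‖F (y + (q - p)) - F y‖ < ε * (r / 2) / 4 := by
    refine (isCompact_closedBall p (r / 2)).eventually_forall_of_forall_eventually
      (P := fun q y => ‖F (y + (q - p)) - F y‖ < ε * (r / 2) / 4) fun y hy => ?_
    have hFy : ContinuousAt F y :=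
      (hball y (closedBall_subset_ball (by linarith) hy)).continuousAt
    have h1 : ContinuousAt (fun z : E × E => F (z.2 + (z.1 - p)) - F z.2) (p, y) := by
      refine ContinuousAt.sub ?_ ?_
      · exact ContinuousAt.comp (f := fun z : E × E => z.2 + (z.1 - p)) (g := F)
          (by simpa using hFy) (by fun_prop)
      · exact ContinuousAt.comp (f := fun z : E × E => z.2) (g := F) hFy (by fun_prop)
    have h2 := h1.norm
    refine h2.eventually_lt continuousAt_const ?_
    simp only [sub_self, add_zero, norm_zero]
    positivity
  filter_upwards [hclose, ball_mem_nhds p hr2] with q hq hqp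
  have hmem : ∀ y ∈ ball p (r / 2), y + (q - p) ∈ ball p r := fun y hy => by
    rw [mem_ball, dist_eq_norm] at *
    calc ‖y + (q - p) - p‖ = ‖(y - p) + (q - p)‖ := by congr 1; abel
      _ ≤ ‖y - p‖ + ‖q - p‖ := norm_add_le _ _
      _ < r := by linarith
  have hd1 : ∀ y ∈ ball p (r / 2), DifferentiableAt ℂ (fun y => F (y + (q - p))) y :=
    fun y hy => DifferentiableAt.comp y (f := fun y => y + (q - p)) (g := F)
      (hball _ (hmem y hy)) (by fun_prop)
  have hd2 : ∀ y ∈ ball p (r / 2), DifferentiableAt ℂ F y :=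
    fun y hy => hball y (ball_subset_ball (by linarith) hy)
  have hp := mem_ball_self (x := p) hr2
  have key := Complex.norm_fderiv_le_div_of_mapsTo_ball
    (f := fun y => F (y + (q - p)) - F y) (c := p) (R₁ := r / 2) (R₂ := ε * (r / 2) / 2)
    (fun y hy => ((hd1 y hy).sub (hd2 y hy)).differentiableWithinAt)
    (fun y hy => by
      have h1 := hq y (ball_subset_closedBall hy)
      have h2 := hq p (ball_subset_closedBall hp)
      rw [mem_closedBall, dist_eq_norm]
      refine (norm_sub_le _ _).trans ?_
      linarith) hr2
  have e : fderiv ℂ (fun y => F (y + (q - p)) - F y) p = fderiv ℂ F q - fderiv ℂ F p := by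
    rw [fderiv_fun_sub (hd1 p hp) (hd2 p hp), fderiv_comp_add_right]
    simp
  rw [e, ← dist_eq_norm] at key
  refine key.trans_lt ?_
  rw [div_div, mul_comm (2:ℝ), ← div_div, mul_div_assoc, div_self hr2.ne']
  linarith

theorem differentiableAt_circleIntegral {X : Type*} [NormedAddCommGroup X]
    [NormedSpace ℂ X] [ProperSpace X] {F : ℂ × X → ℂ} {c : ℂ} {r : ℝ} (hr : 0 ≤ r) {x₀ : X}
    (hF : ∀ w ∈ sphere c r, ∀ᶠ p in 𝓝 (w, x₀), DifferentiableAt ℂ F p) :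
    DifferentiableAt ℂ (fun x => ∮ w in C(c, r), F (w, x)) x₀ := by
  have hcont : ∀ w ∈ sphere c r, ContinuousAt (fderiv ℂ F) (w, x₀) := fun w hw =>
    continuousAt_fderiv_of_eventually_differentiableAt (hF w hw)
  obtain ⟨M, hM⟩ := (isCompact_sphere c r).exists_bound_of_continuousOn
    (f := fun w => fderiv ℂ F (w, x₀)) (fun w hw => ContinuousAt.continuousWithinAt
      (ContinuousAt.comp (f := fun w => (w, x₀)) (hcont w hw) (by fun_prop)))
  have hev : ∀ᶠ x in 𝓝 x₀, ∀ w ∈ sphere c r,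
      DifferentiableAt ℂ F (w, x) ∧ ‖fderiv ℂ F (w, x)‖ ≤ M + 1 := by
    refine (isCompact_sphere c r).eventually_forall_of_forall_eventually
      (P := fun x w => DifferentiableAt ℂ F (w, x) ∧ ‖fderiv ℂ F (w, x)‖ ≤ M + 1) fun w hw => ?_
    have h1 : ∀ᶠ p in 𝓝 (w, x₀), DifferentiableAt ℂ F p ∧ ‖fderiv ℂ F p‖ ≤ M + 1 := by
      refine (hF w hw).and ?_
      refine ((hcont w hw).norm.eventually_lt continuousAt_const
        (lt_of_le_of_lt (hM w hw) (lt_add_one M))).mono fun p hp => hp.le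
    exact (continuous_swap.tendsto (x₀, w)).eventually h1
  obtain ⟨s, hs, hsF⟩ := hev.exists_mem
  have hmem : ∀ θ : ℝ, circleMap c r θ ∈ sphere c r := circleMap_mem_sphere c hr
  have hG : ∀ x ∈ s, ∀ θ : ℝ, HasFDerivAt (fun x => deriv (circleMap c r) θ • F (circleMap c r θ, x))
      (deriv (circleMap c r) θ •
        (fderiv ℂ F (circleMap c r θ, x)).comp (ContinuousLinearMap.inr ℂ ℂ X)) x := by
    intro x hx θ
    have h1 : HasFDerivAt (fun x => F (circleMap c r θ, x)) _ x :=
      HasFDerivAt.comp x (hsF x hx _ (hmem θ)).1.hasFDerivAt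
        (hasFDerivAt_prodMk_right (circleMap c r θ) x)
    exact h1.const_smul (deriv (circleMap c r) θ)
  have hderiv : Continuous fun θ => deriv (circleMap c r) θ := by
    simp only [deriv_circleMap]
    fun_prop
  have hFc : ∀ x ∈ s, Continuous fun θ : ℝ => deriv (circleMap c r) θ • F (circleMap c r θ, x) :=
    fun x hx => hderiv.smul (continuous_iff_continuousAt.2 fun θ =>
      ContinuousAt.comp (f := fun θ : ℝ => (circleMap c r θ, x)) (g := F)
        (hsF x hx _ (hmem θ)).1.continuousAt (by fun_prop))
  refine HasFDerivAt.differentiableAt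
    (intervalIntegral.hasFDerivAt_integral_of_dominated_of_fderiv_le
      (F := fun x θ => deriv (circleMap c r) θ • F (circleMap c r θ, x))
      (F' := fun x θ => deriv (circleMap c r) θ •
        (fderiv ℂ F (circleMap c r θ, x)).comp (ContinuousLinearMap.inr ℂ ℂ X))
      (bound := fun _ => |r| * ((M + 1) * ‖ContinuousLinearMap.inr ℂ ℂ X‖)) hs
      ?_ ?_ ?_ ?_ ?_ ?_)
  · filter_upwards [hs] with x hx
    exact (hFc x hx).aestronglyMeasurable
  · exact (hFc x₀ (mem_of_mem_nhds hs)).intervalIntegrable _ _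
  · refine Continuous.aestronglyMeasurable (hderiv.smul ?_)
    refine Continuous.clm_comp (continuous_iff_continuousAt.2 fun θ => ?_) continuous_const
    exact ContinuousAt.comp (f := fun θ : ℝ => (circleMap c r θ, x₀)) (hcont _ (hmem θ))
      (by fun_prop)
  · refine Eventually.of_forall fun θ _ x hx => ?_
    rw [norm_smul]
    gcongr
    · simp [deriv_circleMap]
    · refine (ContinuousLinearMap.opNorm_comp_le _ _).trans ?_
      gcongr
      exact (hsF x hx _ (hmem θ)).2
  · exact intervalIntegrable_const
  · exact Eventually.of_forall fun θ _ x hx => hG x hx θ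

theorem differentiableAt_deriv_fst {X : Type*} [NormedAddCommGroup X]
    [NormedSpace ℂ X] [ProperSpace X] {F : ℂ × X → ℂ} {p₀ : ℂ × X}
    (hF : ∀ᶠ p in 𝓝 p₀, DifferentiableAt ℂ F p) :
    DifferentiableAt ℂ (fun p : ℂ × X => deriv (fun w => F (w, p.2)) p.1) p₀ := by
  obtain ⟨r, hr, hball⟩ := Metric.eventually_nhds_iff_ball.1 hF
  have hr2 : 0 < r / 2 := by positivity
  have key : DifferentiableAt ℂ (fun p : ℂ × X => ∮ w in C(p₀.1, r / 2),
      ((w - p.1) ^ 2)⁻¹ * F (w, p.2)) p₀ := by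
    refine differentiableAt_circleIntegral
      (F := fun q : ℂ × (ℂ × X) => ((q.1 - q.2.1) ^ 2)⁻¹ * F (q.1, q.2.2)) hr2.le fun w hw => ?_
    have h1 : ∀ᶠ q : ℂ × (ℂ × X) in 𝓝 (w, p₀), q.1 - q.2.1 ≠ 0 := by
      have : ContinuousAt (fun q : ℂ × (ℂ × X) => q.1 - q.2.1) (w, p₀) := by fun_prop
      refine this.eventually_ne ?_
      simpa [sub_ne_zero] using ne_of_mem_sphere hw hr2.ne'
    have h2 : ∀ᶠ q : ℂ × (ℂ × X) in 𝓝 (w, p₀), (q.1, q.2.2) ∈ ball p₀ r := by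
      have : ContinuousAt (fun q : ℂ × (ℂ × X) => (q.1, q.2.2)) (w, p₀) := by fun_prop
      refine this.eventually_mem (isOpen_ball.mem_nhds ?_)
      rw [mem_ball, Prod.dist_eq, dist_self, mem_sphere.1 hw]
      simp [hr]
    filter_upwards [h1, h2] with q hq1 hq2
    have h3 : DifferentiableAt ℂ (fun q : ℂ × (ℂ × X) => F (q.1, q.2.2)) q :=
      DifferentiableAt.comp q (f := fun q : ℂ × (ℂ × X) => (q.1, q.2.2)) (g := F)
        (hball _ hq2) (by fun_prop)
    refine DifferentiableAt.fun_mul (DifferentiableAt.fun_inv (by fun_prop) (pow_ne_zero 2 hq1)) h3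
  refine (key.const_mul (2 * Real.pi * Complex.I)⁻¹).congr_of_eventuallyEq ?_
  filter_upwards [ball_mem_nhds p₀ hr2] with p hp
  rw [mem_ball, Prod.dist_eq, max_lt_iff] at hp
  refine (Complex.two_pi_I_inv_smul_circleIntegral_sub_sq_inv_smul_of_differentiable
    (U := ball p₀.1 r) (f := fun w => F (w, p.2)) isOpen_ball
    (closedBall_subset_ball (by linarith)) (fun w hw => ?_) hp.1).symm
  refine (DifferentiableAt.comp w (f := fun w => (w, p.2)) (g := F)
    (hball _ ?_) (by fun_prop)).differentiableWithinAt
  rw [mem_ball, Prod.dist_eq, max_lt_iff]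
  exact ⟨hw, by linarith [hp.2]⟩

theorem differentiableAt_div {E : Type*} [NormedAddCommGroup E] [NormedSpace ℂ E] {f g : E → ℂ}
    {x : E} (hf : DifferentiableAt ℂ f x) (hg : DifferentiableAt ℂ g x) (h : g x ≠ 0) :
    DifferentiableAt ℂ (fun y => f y / g y) x := by
  simp only [div_eq_mul_inv]
  exact hf.fun_mul (hg.fun_inv h)

theorem differentiableAt_prod {E ι : Type*} [NormedAddCommGroup E] [NormedSpace ℂ E]
    {g : ι → E → ℂ} {I : Finset ι} {x : E} (hg : ∀ i ∈ I, DifferentiableAt ℂ (g i) x) :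
    DifferentiableAt ℂ (fun y => ∏ i ∈ I, g i y) x := by
  classical
  exact (HasFDerivAt.finsetProd fun i hi => (hg i hi).hasFDerivAt).differentiableAt

theorem exists_finset_zeros {h : ℂ → ℂ} {c : ℂ} {r : ℝ} (hr : 0 < r)
    (hh : AnalyticOnNhd ℂ h (closedBall c r)) (hs : ∀ w ∈ sphere c r, h w ≠ 0) :
    ∃ (Z : Finset ℂ) (m : ℂ → ℕ), (∀ w, w ∈ Z ↔ w ∈ ball c r ∧ h w = 0) ∧
      (∀ z ∈ Z, 0 < m z) ∧ ∀ k, zeroMoment h c r k = ∑ z ∈ Z, (m z : ℂ) * z ^ k := by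
  obtain ⟨a, ha⟩ : (sphere c r).Nonempty := NormedSpace.sphere_nonempty.2 hr.le
  have hfin := hh.finite_zeros_closedBall (sphere_subset_closedBall ha) (hs a ha)
  have hZ : ∀ w, w ∈ hfin.toFinset ↔ w ∈ closedBall c r ∧ h w = 0 := fun w => by simp
  obtain ⟨m, hm, hsum⟩ := exists_zeroMoment_eq_sum hr hfin.toFinset h hh hs hZ
  refine ⟨hfin.toFinset, m, fun w => ?_, hm, hsum⟩
  rw [hZ]
  refine ⟨fun hw => ⟨?_, hw.2⟩, fun hw => ⟨ball_subset_closedBall hw.1, hw.2⟩⟩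
  exact (mem_closedBall.1 hw.1).lt_of_ne fun he => hs w he hw.2

/-- The `k`-th leading Hankel determinant of a sequence. -/
noncomputable def hankelDet (s : ℕ → ℂ) (k : ℕ) : ℂ :=
  Matrix.det (Matrix.of fun i j : Fin k => s (i + j))

theorem hankelDet_eq_zero_of_card_lt {Z : Finset ℂ} {m : ℂ → ℕ} {s : ℕ → ℂ}
    (hs : ∀ k, s k = ∑ z ∈ Z, (m z : ℂ) * z ^ k) {k : ℕ} (hk : Z.card < k) :
    hankelDet s k = 0 := by
  by_contra hne
  have hmul : (Matrix.of fun i j : Fin k => s (i + j)) =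
      (Matrix.of fun (i : Fin k) (z : Z) => (m z : ℂ) * (z : ℂ) ^ (i : ℕ)) *
        (Matrix.of fun (z : Z) (j : Fin k) => (z : ℂ) ^ (j : ℕ)) := by
    ext i j
    rw [Matrix.mul_apply, Matrix.of_apply, hs, ← Finset.sum_coe_sort]
    refine Finset.sum_congr rfl fun z _ => ?_
    simp only [Matrix.of_apply]
    ring
  have h1 := Matrix.rank_of_isUnit _ ((Matrix.isUnit_iff_isUnit_det _).2 (isUnit_iff_ne_zero.2 hne))
  rw [hmul] at h1
  have h2 := (Matrix.rank_mul_le_left (Matrix.of fun (i : Fin k) (z : Z) =>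
    (m z : ℂ) * (z : ℂ) ^ (i : ℕ)) (Matrix.of fun (z : Z) (j : Fin k) => (z : ℂ) ^ (j : ℕ))).trans
    (Matrix.rank_le_card_width _)
  rw [h1, Fintype.card_fin, Fintype.card_coe] at h2
  omega

theorem hankelDet_card_ne_zero {Z : Finset ℂ} {m : ℂ → ℕ} {s : ℕ → ℂ}
    (hm : ∀ z ∈ Z, 0 < m z) (hs : ∀ k, s k = ∑ z ∈ Z, (m z : ℂ) * z ^ k) :
    hankelDet s Z.card ≠ 0 := by
  set v : Fin Z.card → ℂ := fun a => (Z.equivFin.symm a : ℂ) with hv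
  have hvinj : Function.Injective v := Subtype.val_injective.comp Z.equivFin.symm.injective
  have hmul : (Matrix.of fun i j : Fin Z.card => s (i + j)) =
      (Matrix.vandermonde v).transpose * Matrix.diagonal (fun a => (m (v a) : ℂ)) *
        Matrix.vandermonde v := by
    ext i j
    rw [Matrix.mul_apply, Matrix.of_apply, hs, ← Finset.sum_coe_sort,
      ← Equiv.sum_comp Z.equivFin.symm]
    refine Finset.sum_congr rfl fun a _ => ?_
    simp only [Matrix.mul_diagonal, Matrix.transpose_apply, Matrix.vandermonde_apply, hv]
    ring
  rw [hankelDet, hmul, Matrix.det_mul, Matrix.det_mul, Matrix.det_transpose, Matrix.det_diagonal]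
  have h1 := Matrix.det_vandermonde_ne_zero_iff.2 hvinj
  refine mul_ne_zero (mul_ne_zero h1 (Finset.prod_ne_zero_iff.2 fun a _ => ?_)) h1
  exact_mod_cast (hm _ (Z.equivFin.symm a).2).ne'

section Parametric

variable {X : Type*} [NormedAddCommGroup X] [NormedSpace ℂ X]
  {P : ℂ × X → ℂ} {c : ℂ} {r : ℝ} {x₀ : X}

theorem eventually_analyticOnNhd_closedBall
    (hP : ∀ w ∈ closedBall c r, ∀ᶠ p in 𝓝 (w, x₀), DifferentiableAt ℂ P p) :
    ∀ᶠ x in 𝓝 x₀, AnalyticOnNhd ℂ (fun w => P (w, x)) (closedBall c r) := by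
  refine (isCompact_closedBall c r).eventually_forall_of_forall_eventually
    (P := fun x w => AnalyticAt ℂ (fun w => P (w, x)) w) fun w hw => ?_
  have h1 := (continuous_swap.tendsto (x₀, w)).eventually (hP w hw).eventually_nhds
  refine h1.mono fun q hq => ?_
  rw [Complex.analyticAt_iff_eventually_differentiableAt]
  have h2 : ContinuousAt (fun w => (w, q.1)) q.2 := by fun_prop
  refine (h2.eventually hq).mono fun w hw => ?_
  exact DifferentiableAt.comp w (f := fun w => (w, q.1)) (g := P) hw (by fun_prop)

theorem eventually_forall_sphere_ne_zero {X : Type*} [TopologicalSpace X]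
    {P : ℂ × X → ℂ} {c : ℂ} {r : ℝ} {x₀ : X}
    (hP : ∀ w ∈ sphere c r, ContinuousAt P (w, x₀))
    (hs : ∀ w ∈ sphere c r, P (w, x₀) ≠ 0) :
    ∀ᶠ x in 𝓝 x₀, ∀ w ∈ sphere c r, P (w, x) ≠ 0 := by
  refine (isCompact_sphere c r).eventually_forall_of_forall_eventually
    (P := fun x w => P (w, x) ≠ 0) fun w hw => ?_
  exact (continuous_swap.tendsto (x₀, w)).eventually ((hP w hw).eventually_ne (hs w hw))

theorem differentiableAt_zeroMoment [ProperSpace X] (hr : 0 ≤ r)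
    (hP : ∀ w ∈ sphere c r, ∀ᶠ p in 𝓝 (w, x₀), DifferentiableAt ℂ P p)
    (hs : ∀ w ∈ sphere c r, P (w, x₀) ≠ 0) (k : ℕ) :
    DifferentiableAt ℂ (fun x => zeroMoment (fun w => P (w, x)) c r k) x₀ := by
  refine DifferentiableAt.const_mul (differentiableAt_circleIntegral
    (F := fun p : ℂ × X => p.1 ^ k * (deriv (fun w => P (w, p.2)) p.1 / P p)) hr
    fun w hw => ?_) _
  filter_upwards [(hP w hw).eventually_nhds,
    (hP w hw).self_of_nhds.continuousAt.eventually_ne (hs w hw)] with p hp hp0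
  have h1 : DifferentiableAt ℂ (fun p : ℂ × X => deriv (fun w => P (w, p.2)) p.1 / P p) p :=
    differentiableAt_div (differentiableAt_deriv_fst hp) hp.self_of_nhds hp0
  exact DifferentiableAt.fun_mul (by fun_prop) h1

theorem eventually_exists_zero_mem_ball [ProperSpace X] (hr : 0 < r)
    (hP : ∀ w ∈ closedBall c r, ∀ᶠ p in 𝓝 (w, x₀), DifferentiableAt ℂ P p)
    (hs : ∀ w ∈ sphere c r, P (w, x₀) ≠ 0) {z : ℂ} (hz : z ∈ ball c r) (hPz : P (z, x₀) = 0) :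
    ∀ᶠ x in 𝓝 x₀, ∃ w ∈ ball c r, P (w, x) = 0 := by
  have han := eventually_analyticOnNhd_closedBall hP
  have hne := eventually_forall_sphere_ne_zero
    (fun w hw => (hP w (sphere_subset_closedBall hw)).self_of_nhds.continuousAt) hs
  obtain ⟨Z, m, hZ, hm, hsum⟩ := exists_finset_zeros hr han.self_of_nhds hs
  have h0 : zeroMoment (fun w => P (w, x₀)) c r 0 ≠ 0 := by
    rw [hsum 0]
    simp only [pow_zero, mul_one]
    have : 0 < ∑ z ∈ Z, m z := (hm z ((hZ z).2 ⟨hz, hPz⟩)).trans_le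
      (Finset.single_le_sum (f := m) (fun _ _ => Nat.zero_le _) ((hZ z).2 ⟨hz, hPz⟩))
    exact_mod_cast this.ne'
  have hcont := (differentiableAt_zeroMoment hr.le
    (fun w hw => hP w (sphere_subset_closedBall hw)) hs 0).continuousAt.eventually_ne h0
  filter_upwards [han, hne, hcont] with x h1 h2 h3
  obtain ⟨Z', m', hZ', -, hsum'⟩ := exists_finset_zeros hr h1 h2
  rw [hsum' 0] at h3
  obtain ⟨w, hw, -⟩ := Finset.exists_ne_zero_of_sum_ne_zero h3
  exact ⟨w, (hZ' w).1 hw⟩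

end Parametric

/-- The zeros of `P (·, x)` in the open disc of radius `δ` around `0`. -/
def fiberZeros {X : Type*} (P : ℂ × X → ℂ) (δ : ℝ) (x : X) : Set ℂ :=
  {w | w ∈ ball 0 δ ∧ P (w, x) = 0}

theorem exists_pos_separated {Z : Set ℂ} (hZ : Z.Finite) {δ : ℝ} (hZδ : Z ⊆ ball 0 δ) :
    ∃ r > 0, ∀ y ∈ Z, closedBall y r ⊆ ball 0 δ ∧
      ∀ y' ∈ Z, y ≠ y' → Disjoint (closedBall y r) (closedBall y' r) := by
  have h : ∀ᶠ r in 𝓝[>] (0 : ℝ), ∀ y ∈ Z, r < δ - dist y 0 ∧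
      ∀ y' ∈ Z, y ≠ y' → r < dist y y' / 2 := by
    refine (Filter.eventually_all_finite hZ).2 fun y hy => Eventually.and ?_ ?_
    · exact mem_nhdsWithin_of_mem_nhds (Iio_mem_nhds (sub_pos.2 (hZδ hy)))
    · refine (Filter.eventually_all_finite hZ).2 fun y' hy' => ?_
      by_cases hne : y = y'
      · simp [hne]
      · filter_upwards [mem_nhdsWithin_of_mem_nhds (Iio_mem_nhds (half_pos (dist_pos.2 hne)))]
          with r hr _ using hr
  obtain ⟨r, hr, hr0⟩ := (h.and self_mem_nhdsWithin).exists
  refine ⟨r, hr0, fun y hy => ⟨fun w hw => ?_, fun y' hy' hne => ?_⟩⟩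
  · rw [mem_ball]
    linarith [dist_triangle w y 0, mem_closedBall.1 hw, (hr y hy).1]
  · exact closedBall_disjoint_closedBall (by linarith [(hr y hy).2 y' hy' hne])

theorem exists_differentiableAt_bijOn_fiberZeros {X : Type*} [NormedAddCommGroup X]
    [NormedSpace ℂ X] [ProperSpace X] {P : ℂ × X → ℂ} {δ : ℝ} (hδ : 0 < δ) {x₀ : X} {T : Set X}
    (hP : ∀ w ∈ closedBall 0 δ, ∀ᶠ p in 𝓝 (w, x₀), DifferentiableAt ℂ P p)
    (hs : ∀ w ∈ sphere 0 δ, P (w, x₀) ≠ 0)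
    (hcard : ∀ᶠ x in 𝓝[T] x₀, (fiberZeros P δ x).ncard = (fiberZeros P δ x₀).ncard) :
    ∃ r > 0, ∃ ρ : ℂ → X → ℂ,
      (∀ y ∈ fiberZeros P δ x₀, closedBall y r ⊆ ball 0 δ ∧
        (∀ w ∈ closedBall y r, P (w, x₀) = 0 → w = y) ∧
        DifferentiableAt ℂ (ρ y) x₀ ∧ ρ y x₀ = y) ∧
      ∀ᶠ x in 𝓝[T] x₀, BijOn (fun y => ρ y x) (fiberZeros P δ x₀) (fiberZeros P δ x) ∧
        ∀ y ∈ fiberZeros P δ x₀, ∀ w ∈ ball y r, P (w, x) = 0 → w = ρ y x := by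
  have hfin : ∀ᶠ x in 𝓝 x₀, (fiberZeros P δ x).Finite := by
    filter_upwards [eventually_analyticOnNhd_closedBall hP, eventually_forall_sphere_ne_zero
      (fun w hw => (hP w (sphere_subset_closedBall hw)).self_of_nhds.continuousAt) hs] with x h1 h2
    obtain ⟨Z, -, hZ, -⟩ := exists_finset_zeros hδ h1 h2
    exact Z.finite_toSet.subset fun w hw => (hZ w).2 hw
  have hfin₀ := hfin.self_of_nhds
  obtain ⟨r, hr, hsep⟩ := exists_pos_separated hfin₀ (δ := δ) (fun w hw => hw.1)
  have hsub : ∀ y ∈ fiberZeros P δ x₀, closedBall y r ⊆ closedBall 0 δ := fun y hy =>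
    (hsep y hy).1.trans ball_subset_closedBall
  have honly : ∀ y ∈ fiberZeros P δ x₀, ∀ w ∈ closedBall y r, P (w, x₀) = 0 → w = y := by
    intro y hy w hw h0
    by_contra hne
    exact disjoint_left.1 ((hsep y hy).2 w ⟨(hsep y hy).1 hw, h0⟩ (Ne.symm hne)) hw
      (mem_closedBall_self hr.le)
  have hPy : ∀ y ∈ fiberZeros P δ x₀, ∀ w ∈ closedBall y r,
      ∀ᶠ p in 𝓝 (w, x₀), DifferentiableAt ℂ P p := fun y hy w hw => hP w (hsub y hy hw)
  have hsy : ∀ y ∈ fiberZeros P δ x₀, ∀ w ∈ sphere y r, P (w, x₀) ≠ 0 := fun y hy w hw h0 => by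
    have := honly y hy w (sphere_subset_closedBall hw) h0
    exact ne_of_mem_sphere hw hr.ne' this
  have hratio : ∀ x, ∀ y, ∀ z ∈ ball y r, P (z, x) = 0 →
      AnalyticOnNhd ℂ (fun w => P (w, x)) (closedBall y r) →
      (∀ w ∈ sphere y r, P (w, x) ≠ 0) → (∀ w ∈ ball y r, P (w, x) = 0 → w = z) →
      zeroMoment (fun w => P (w, x)) y r 0 ≠ 0 ∧
      zeroMoment (fun w => P (w, x)) y r 1 / zeroMoment (fun w => P (w, x)) y r 0 = z := by
    intro x y z hz hz0 h1 h2 h3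
    obtain ⟨Z, m, hZ, hm, hsum⟩ := exists_finset_zeros hr h1 h2
    have hZz : Z = {z} := by
      ext w
      rw [hZ, Finset.mem_singleton]
      exact ⟨fun hw => h3 w hw.1 hw.2, fun hw => hw ▸ ⟨hz, hz0⟩⟩
    have hmz : (m z : ℂ) ≠ 0 := by
      exact_mod_cast (hm z (by simp [hZz])).ne'
    rw [hsum, hsum, hZz]
    simp [hmz]
  refine ⟨r, hr, fun y x => zeroMoment (fun w => P (w, x)) y r 1 /
    zeroMoment (fun w => P (w, x)) y r 0, fun y hy => ⟨(hsep y hy).1, honly y hy, ?_⟩, ?_⟩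
  · have h := hratio x₀ y y (mem_ball_self hr) hy.2
      (eventually_analyticOnNhd_closedBall (hPy y hy)).self_of_nhds (hsy y hy)
      (fun w hw => honly y hy w (ball_subset_closedBall hw))
    have hd := differentiableAt_zeroMoment hr.le
      (fun w hw => hPy y hy w (sphere_subset_closedBall hw)) (hsy y hy)
    exact ⟨differentiableAt_div (hd 1) (hd 0) h.1, h.2⟩
  · have hall : ∀ᶠ x in 𝓝 x₀, ∀ y ∈ fiberZeros P δ x₀,
        (∃ w ∈ ball y r, P (w, x) = 0) ∧ AnalyticOnNhd ℂ (fun w => P (w, x)) (closedBall y r) ∧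
        ∀ w ∈ sphere y r, P (w, x) ≠ 0 := by
      refine (Filter.eventually_all_finite hfin₀).2 fun y hy => ?_
      exact (eventually_exists_zero_mem_ball hr (hPy y hy) (hsy y hy) (mem_ball_self hr) hy.2).and
        ((eventually_analyticOnNhd_closedBall (hPy y hy)).and
        (eventually_forall_sphere_ne_zero (fun w hw =>
          (hPy y hy w (sphere_subset_closedBall hw)).self_of_nhds.continuousAt) (hsy y hy)))
    filter_upwards [hcard, mem_nhdsWithin_of_mem_nhds hfin, mem_nhdsWithin_of_mem_nhds hall]
      with x hxcard hxfin hx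
    choose! z hzball hz0 using fun y hy => (hx y hy).1
    have hmaps : MapsTo z (fiberZeros P δ x₀) (fiberZeros P δ x) := fun y hy =>
      ⟨(hsep y hy).1 (ball_subset_closedBall (hzball y hy)), hz0 y hy⟩
    have hinj : InjOn z (fiberZeros P δ x₀) := by
      intro y hy y' hy' he
      by_contra hne
      refine disjoint_left.1 ((hsep y hy).2 y' hy' hne) (ball_subset_closedBall (hzball y hy)) ?_
      rw [he]
      exact ball_subset_closedBall (hzball y' hy')
    have hsurj : SurjOn z (fiberZeros P δ x₀) (fiberZeros P δ x) := fun w hw => by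
      obtain ⟨y, hy, rfl⟩ := Set.surj_on_of_inj_on_of_ncard_le (fun y _ => z y) hmaps
        (fun y y' hy hy' he => hinj hy hy' he) hxcard.le hxfin w hw
      exact ⟨y, hy, rfl⟩
    have huniq : ∀ y ∈ fiberZeros P δ x₀, ∀ w ∈ ball y r, P (w, x) = 0 → w = z y := by
      intro y hy w hw hw0
      obtain ⟨y', hy', rfl⟩ := hsurj ⟨(hsep y hy).1 (ball_subset_closedBall hw), hw0⟩
      by_contra hne
      refine disjoint_left.1 ((hsep y hy).2 y' hy' ?_) (ball_subset_closedBall hw)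
        (ball_subset_closedBall (hzball y' hy'))
      rintro rfl
      exact hne rfl
    have hρ : ∀ y ∈ fiberZeros P δ x₀, z y = zeroMoment (fun w => P (w, x)) y r 1 /
        zeroMoment (fun w => P (w, x)) y r 0 := fun y hy =>
      (hratio x y (z y) (hzball y hy) (hz0 y hy) (hx y hy).2.1 (hx y hy).2.2 (huniq y hy)).2.symm
    exact ⟨BijOn.congr ⟨hmaps, hinj, hsurj⟩ hρ, fun y hy w hw hw0 =>
      (huniq y hy w hw hw0).trans (hρ y hy)⟩

theorem exists_differentiableAt_bijOn_pattern {X ι : Type*} [NormedAddCommGroup X]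
    [NormedSpace ℂ X] [ProperSpace X] [Finite ι] {g : ι → ℂ × X → ℂ} {I : Finset ι}
    {δ : ℝ} (hδ : 0 < δ) {x₀ : X} {T : Set X}
    (hg : ∀ i, ∀ w ∈ closedBall 0 δ, ∀ᶠ p in 𝓝 (w, x₀), DifferentiableAt ℂ (g i) p)
    (hg0 : ∀ i ∉ I, ∀ w ∈ closedBall 0 δ, ∀ᶠ p in 𝓝 (w, x₀), g i p = 0)
    (hs : ∀ w ∈ sphere 0 δ, ∏ i ∈ I, g i (w, x₀) ≠ 0)
    (hcard : ∀ᶠ x in 𝓝[T] x₀, (fiberZeros (fun p => ∏ i ∈ I, g i p) δ x).ncard =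
      (fiberZeros (fun p => ∏ i ∈ I, g i p) δ x₀).ncard) :
    ∃ ρ : ℂ → X → ℂ,
      (∀ y ∈ fiberZeros (fun p => ∏ i ∈ I, g i p) δ x₀,
        DifferentiableAt ℂ (ρ y) x₀ ∧ ρ y x₀ = y) ∧
      ∀ᶠ x in 𝓝[T] x₀, BijOn (fun y => ρ y x) (fiberZeros (fun p => ∏ i ∈ I, g i p) δ x₀)
          (fiberZeros (fun p => ∏ i ∈ I, g i p) δ x) ∧
        ∀ y ∈ fiberZeros (fun p => ∏ i ∈ I, g i p) δ x₀, ∀ i,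
          (g i (ρ y x, x) = 0 ↔ g i (y, x₀) = 0) := by
  have hP : ∀ w ∈ closedBall 0 δ, ∀ᶠ p in 𝓝 (w, x₀),
      DifferentiableAt ℂ (fun p => ∏ i ∈ I, g i p) p := fun w hw => by
    filter_upwards [Filter.eventually_all.2 fun i => hg i w hw] with p hp
    exact differentiableAt_prod fun i _ => hp i
  obtain ⟨r, hr, ρ, hρ, hbij⟩ := exists_differentiableAt_bijOn_fiberZeros hδ hP hs hcard
  have hfin : (fiberZeros (fun p => ∏ i ∈ I, g i p) δ x₀).Finite := by
    obtain ⟨Z, -, hZ, -⟩ := exists_finset_zeros hδ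
      (eventually_analyticOnNhd_closedBall hP).self_of_nhds hs
    exact Z.finite_toSet.subset fun w hw => (hZ w).2 hw
  refine ⟨ρ, fun y hy => (hρ y hy).2.2, ?_⟩
  have hpat : ∀ᶠ x in 𝓝[T] x₀, ∀ y ∈ fiberZeros (fun p => ∏ i ∈ I, g i p) δ x₀, ∀ i,
      (g i (ρ y x, x) = 0 ↔ g i (y, x₀) = 0) := by
    refine (Filter.eventually_all_finite hfin).2 fun y hy => Filter.eventually_all.2 fun i => ?_
    obtain ⟨hsub, honly, hd, hy0⟩ := hρ y hy
    have hy' : y ∈ closedBall 0 δ := ball_subset_closedBall hy.1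
    have hc : ContinuousAt (fun x => (ρ y x, x)) x₀ := hd.continuousAt.prodMk continuousAt_id
    have ht : Tendsto (fun x => (ρ y x, x)) (𝓝 x₀) (𝓝 (y, x₀)) := by
      have := hc.tendsto
      rwa [hy0] at this
    by_cases hi : i ∈ I
    · by_cases h0 : g i (y, x₀) = 0
      · have hev := eventually_exists_zero_mem_ball hr
          (fun w hw => hg i w (ball_subset_closedBall (hsub hw)))
          (fun w hw h0 => ne_of_mem_sphere hw hr.ne'
            (honly w (sphere_subset_closedBall hw) (Finset.prod_eq_zero hi h0)))
          (mem_ball_self hr) h0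
        filter_upwards [hbij, mem_nhdsWithin_of_mem_nhds hev] with x hx hx'
        obtain ⟨w, hw, hw0⟩ := hx'
        rw [← hx.2 y hy w hw (Finset.prod_eq_zero hi hw0)]
        simp [h0, hw0]
      · have := ht.eventually ((hg i y hy').self_of_nhds.continuousAt.eventually_ne h0)
        filter_upwards [mem_nhdsWithin_of_mem_nhds this] with x hx
        simp [h0, hx]
    · filter_upwards [mem_nhdsWithin_of_mem_nhds (ht.eventually (hg0 i hi y hy'))] with x hx
      simp [hx, (hg0 i hi y hy').self_of_nhds]
  filter_upwards [hbij, hpat] with x h1 h2 using ⟨h1.1, h2⟩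

/-- The points where the vanishing functions among the `g i` are exactly those indexed by `A`. -/
def stratum {ι E : Type*} (g : ι → E → ℂ) (A : Set ι) : Set E :=
  {x | ∀ i, g i x = 0 ↔ i ∈ A}

/-- `φ` has zero derivative at `x` along `S`. -/
def IsFlatAlong {E : Type*} [NormedAddCommGroup E] (φ : E → ℝ) (S : Set E) (x : E) : Prop :=
  (fun z => φ z - φ x) =o[𝓝[S] x] fun z => z - x

/-- The points of a stratum lying in the open disc of radius `δ` in the fiber over `x`. -/
def fiberStratum {ι X : Type*} (g : ι → ℂ × X → ℂ) (A : Set ι) (δ : ℝ) (x : X) : Set ℂ :=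
  {y | y ∈ ball 0 δ ∧ (y, x) ∈ stratum g A}

theorem fiberStratum_subset_fiberZeros {ι X : Type*} {g : ι → ℂ × X → ℂ} {A : Set ι}
    {I : Finset ι} (hAI : ∃ i ∈ I, i ∈ A) (δ : ℝ) (x : X) :
    fiberStratum g A δ x ⊆ fiberZeros (fun p => ∏ i ∈ I, g i p) δ x := by
  obtain ⟨i, hi, hiA⟩ := hAI
  exact fun y hy => ⟨hy.1, Finset.prod_eq_zero hi ((hy.2 i).2 hiA)⟩

theorem isFlatAlong_finsum_fiberStratum {X ι : Type*} [NormedAddCommGroup X]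
    [NormedSpace ℂ X] [ProperSpace X] [Finite ι] {g : ι → ℂ × X → ℂ} {I : Finset ι} {A : Set ι}
    (hAI : ∃ i ∈ I, i ∈ A) {δ : ℝ} (hδ : 0 < δ) {x₀ : X} {T : Set X}
    (hg : ∀ i, ∀ w ∈ closedBall 0 δ, ∀ᶠ p in 𝓝 (w, x₀), DifferentiableAt ℂ (g i) p)
    (hg0 : ∀ i ∉ I, ∀ w ∈ closedBall 0 δ, ∀ᶠ p in 𝓝 (w, x₀), g i p = 0)
    (hs : ∀ w ∈ sphere 0 δ, ∏ i ∈ I, g i (w, x₀) ≠ 0)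
    (hcard : ∀ᶠ x in 𝓝[T] x₀, (fiberZeros (fun p => ∏ i ∈ I, g i p) δ x).ncard =
      (fiberZeros (fun p => ∏ i ∈ I, g i p) δ x₀).ncard) {φ : ℂ × X → ℝ}
    (hφ : ∀ y ∈ fiberStratum g A δ x₀, IsFlatAlong φ (stratum g A) (y, x₀)) :
    IsFlatAlong (fun x => ∑ᶠ y ∈ fiberStratum g A δ x, |φ (y, x)|) T x₀ := by
  obtain ⟨ρ, hρ, hbij⟩ := exists_differentiableAt_bijOn_pattern hδ hg hg0 hs hcard
  have hsub := fiberStratum_subset_fiberZeros (g := g) hAI δ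
  have hfin : (fiberStratum g A δ x₀).Finite := by
    have hP : ∀ w ∈ closedBall 0 δ, ∀ᶠ p in 𝓝 (w, x₀),
        DifferentiableAt ℂ (fun p => ∏ i ∈ I, g i p) p := fun w hw => by
      filter_upwards [Filter.eventually_all.2 fun i => hg i w hw] with p hp
      exact differentiableAt_prod fun i _ => hp i
    obtain ⟨Z, -, hZ, -⟩ := exists_finset_zeros hδ
      (eventually_analyticOnNhd_closedBall hP).self_of_nhds hs
    exact Z.finite_toSet.subset fun w hw => (hZ w).2 (hsub x₀ hw)
  have hsum : ∀ᶠ x in 𝓝[T] x₀, (∑ᶠ y ∈ fiberStratum g A δ x, |φ (y, x)|) -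
      (∑ᶠ y ∈ fiberStratum g A δ x₀, |φ (y, x₀)|) =
      ∑ y ∈ hfin.toFinset, (|φ (ρ y x, x)| - |φ (y, x₀)|) := by
    filter_upwards [hbij] with x hx
    have hb : BijOn (fun y => ρ y x) (fiberStratum g A δ x₀) (fiberStratum g A δ x) := by
      refine ⟨fun y hy => ⟨(hx.1.mapsTo (hsub x₀ hy)).1, fun i => ?_⟩,
        hx.1.injOn.mono (hsub x₀), fun w hw => ?_⟩
      · exact (hx.2 y (hsub x₀ hy) i).trans (hy.2 i)
      · obtain ⟨y, hy, rfl⟩ := hx.1.surjOn (hsub x hw)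
        exact ⟨y, ⟨hy.1, fun i => (hx.2 y hy i).symm.trans (hw.2 i)⟩, rfl⟩
    rw [← finsum_mem_eq_of_bijOn (f := fun y => |φ (ρ y x, x)|) _ hb fun y _ => rfl,
      finsum_mem_eq_finite_toFinset_sum _ hfin, finsum_mem_eq_finite_toFinset_sum _ hfin,
      Finset.sum_sub_distrib]
  refine IsLittleO.congr' ?_ (hsum.mono fun x hx => hx.symm) EventuallyEq.rfl
  refine IsLittleO.fun_sum fun y hy => ?_
  rw [Set.Finite.mem_toFinset] at hy
  obtain ⟨hd, hy0⟩ := hρ y (hsub x₀ hy)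
  have hdΦ : DifferentiableAt ℂ (fun x => (ρ y x, x)) x₀ := hd.prodMk differentiableAt_id
  have ht : Tendsto (fun x => (ρ y x, x)) (𝓝[T] x₀) (𝓝[stratum g A] (y, x₀)) := by
    refine tendsto_nhdsWithin_iff.2 ⟨?_, ?_⟩
    · have := hdΦ.continuousAt.tendsto
      rw [hy0] at this
      exact this.mono_left nhdsWithin_le_nhds
    · filter_upwards [hbij] with x hx i
      exact (hx.2 y (hsub x₀ hy) i).trans (hy.2 i)
  have h1 := (hφ y hy).comp_tendsto ht
  have h2 : (fun x => ((ρ y x, x) : ℂ × X) - (y, x₀)) =O[𝓝[T] x₀] fun x => x - x₀ := by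
    have := hdΦ.isBigO_sub
    simp only [hy0] at this
    exact this.mono nhdsWithin_le_nhds
  refine IsBigO.trans_isLittleO (isBigO_of_le _ fun x => ?_) (h1.trans_isBigO h2)
  simpa only [Real.norm_eq_abs, Function.comp_apply] using
    abs_abs_sub_abs_le (φ (ρ y x, x)) (φ (y, x₀))

/-- Near the origin, every function that is flat along a stratum and tends to `0` at the origin
vanishes on that stratum. -/
def FlatFunctionsVanish (E : Type) [NormedAddCommGroup E] [NormedSpace ℂ E] : Prop :=
  ∀ (ι : Type) [Finite ι] (g : ι → E → ℂ) (A : Set ι) (φ : E → ℝ),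
    (∀ i, ∀ᶠ x in 𝓝 0, DifferentiableAt ℂ (g i) x) →
    (∀ᶠ x in 𝓝 0, x ∈ stratum g A → IsFlatAlong φ (stratum g A) x) →
    Tendsto φ (𝓝[stratum g A] 0) (𝓝 0) →
    ∀ᶠ x in 𝓝[stratum g A] 0, φ x = 0

theorem fiberZeros_hankelDet {X : Type*} [NormedAddCommGroup X] [NormedSpace ℂ X]
    {P : ℂ × X → ℂ} {δ : ℝ} (hδ : 0 < δ) {x : X}
    (hP : ∀ w ∈ closedBall 0 δ, ∀ᶠ p in 𝓝 (w, x), DifferentiableAt ℂ P p)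
    (hs : ∀ w ∈ sphere 0 δ, P (w, x) ≠ 0) :
    (fiberZeros P δ x).Finite ∧
      ((fiberZeros P δ x).ncard : ℝ) ≤ ‖zeroMoment (fun w => P (w, x)) 0 δ 0‖ ∧
      hankelDet (zeroMoment (fun w => P (w, x)) 0 δ) (fiberZeros P δ x).ncard ≠ 0 ∧
      ∀ k, (fiberZeros P δ x).ncard < k →
        hankelDet (zeroMoment (fun w => P (w, x)) 0 δ) k = 0 := by
  obtain ⟨Z, m, hZ, hm, hsum⟩ := exists_finset_zeros hδ
    (eventually_analyticOnNhd_closedBall hP).self_of_nhds hs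
  have hZ' : fiberZeros P δ x = Z := by
    ext w
    exact (hZ w).symm
  rw [hZ', Set.ncard_coe_finset]
  refine ⟨Z.finite_toSet, ?_, hankelDet_card_ne_zero hm hsum,
    fun k hk => hankelDet_eq_zero_of_card_lt hsum hk⟩
  rw [hsum 0]
  simp only [pow_zero, mul_one]
  rw [← Nat.cast_sum, Complex.norm_natCast]
  have : Z.card ≤ ∑ z ∈ Z, m z := by
    rw [Finset.card_eq_sum_ones]
    exact Finset.sum_le_sum fun z hz => hm z hz
  exact_mod_cast this

theorem differentiableAt_hankelDet {X : Type*} [NormedAddCommGroup X] [NormedSpace ℂ X]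
    {s : X → ℕ → ℂ} {x : X} (hs : ∀ k, DifferentiableAt ℂ (fun x => s x k) x) (k : ℕ) :
    DifferentiableAt ℂ (fun x => hankelDet (s x) k) x := by
  simp only [hankelDet, Matrix.det_apply']
  refine DifferentiableAt.fun_sum fun σ _ => DifferentiableAt.const_mul ?_ _
  exact differentiableAt_prod fun i _ => hs _

theorem FlatFunctionsVanish.prod_of_fiber_ne_zero {X : Type} [NormedAddCommGroup X]
    [NormedSpace ℂ X] [ProperSpace X] (hX : FlatFunctionsVanish X) {ι : Type} [Finite ι]
    {g : ι → ℂ × X → ℂ} {I : Finset ι} {A : Set ι} (hAI : ∃ i ∈ I, i ∈ A) {φ : ℂ × X → ℝ}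
    (hg : ∀ i, ∀ᶠ p in 𝓝 0, DifferentiableAt ℂ (g i) p)
    (hg0 : ∀ i ∉ I, ∀ᶠ p in 𝓝 0, g i p = 0)
    (hne : ¬ ∀ᶠ w in 𝓝 (0 : ℂ), ∏ i ∈ I, g i (w, 0) = 0)
    (hφ : ∀ᶠ p in 𝓝 0, p ∈ stratum g A → IsFlatAlong φ (stratum g A) p)
    (hφ0 : Tendsto φ (𝓝[stratum g A] 0) (𝓝 0)) :
    ∀ᶠ p in 𝓝[stratum g A] 0, φ p = 0 := by
  set P : ℂ × X → ℂ := fun p => ∏ i ∈ I, g i p with hPdef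
  have hall : ∀ᶠ p in 𝓝 (0 : ℂ × X), ((∀ i, DifferentiableAt ℂ (g i) p) ∧
      (∀ i ∉ I, g i p = 0)) ∧ (p ∈ stratum g A → IsFlatAlong φ (stratum g A) p) := by
    refine ((Filter.eventually_all.2 hg).and (Filter.eventually_all.2 fun i => ?_)).and hφ
    by_cases hi : i ∈ I
    · simp [hi]
    · filter_upwards [hg0 i hi] with p hp _ using hp
  obtain ⟨ε, hε, hball⟩ := Metric.eventually_nhds_iff_ball.1 hall.eventually_nhds
  have hPd : ∀ p, (∀ i, DifferentiableAt ℂ (g i) p) → DifferentiableAt ℂ P p := fun p hp =>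
    differentiableAt_prod fun i _ => hp i
  obtain ⟨δ, hδ, hδε, hδne⟩ : ∃ δ > 0, δ < ε ∧ ∀ w ∈ closedBall (0 : ℂ) δ, w ≠ 0 →
      P (w, 0) ≠ 0 := by
    have han : AnalyticAt ℂ (fun w : ℂ => P (w, 0)) 0 := by
      refine (eventually_analyticOnNhd_closedBall (P := P) (c := 0) (r := 0) (x₀ := 0)
        fun w hw => ?_).self_of_nhds 0 (by simp)
      obtain rfl : w = 0 := by simpa using hw
      exact hall.mono fun p hp => hPd p hp.1.1
    have h1 := han.eventually_eq_zero_or_eventually_ne_zero.resolve_left hne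
    obtain ⟨r, hr, h2⟩ := Metric.eventually_nhds_iff_ball.1 (eventually_nhdsWithin_iff.1 h1)
    refine ⟨min ε r / 2, by positivity, by linarith [min_le_left ε r], fun w hw hw0 =>
      h2 w (closedBall_subset_ball ?_ hw) hw0⟩
    linarith [min_le_right ε r, lt_min hε hr]
  have hmem : ∀ x : X, ‖x‖ < ε → ∀ w ∈ closedBall (0 : ℂ) δ, (w, x) ∈ ball (0 : ℂ × X) ε := by
    intro x hx w hw
    rw [mem_ball_zero_iff, Prod.norm_def]
    exact max_lt ((mem_closedBall_zero_iff.1 hw).trans_lt hδε) hx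
  have hlt : ∀ᶠ x : X in 𝓝 0, ‖x‖ < ε := by
    filter_upwards [ball_mem_nhds (0 : X) hε] with x hx using mem_ball_zero_iff.1 hx
  have hPx : ∀ x : X, ‖x‖ < ε → ∀ w ∈ closedBall 0 δ,
      ∀ᶠ p in 𝓝 (w, x), DifferentiableAt ℂ P p := fun x hx w hw =>
    (hball _ (hmem x hx w hw)).mono fun p hp => hPd p hp.1.1
  have hsph : ∀ᶠ x : X in 𝓝 0, ∀ w ∈ sphere 0 δ, P (w, x) ≠ 0 :=
    eventually_forall_sphere_ne_zero
      (fun w hw => (hPx 0 (by simpa) w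
        (sphere_subset_closedBall hw)).self_of_nhds.continuousAt)
      fun w hw => hδne w (sphere_subset_closedBall hw) (ne_of_mem_sphere hw hδ.ne')
  have hmom : ∀ x, ‖x‖ < ε → (∀ w ∈ sphere 0 δ, P (w, x) ≠ 0) → ∀ k,
      DifferentiableAt ℂ (fun x => zeroMoment (fun w => P (w, x)) 0 δ k) x := fun x hx hxs =>
    differentiableAt_zeroMoment hδ.le (fun w hw => hPx x hx w (sphere_subset_closedBall hw)) hxs
  obtain ⟨M, hM⟩ : ∃ M : ℕ, ∀ᶠ x : X in 𝓝 0, (fiberZeros P δ x).ncard ≤ M := by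
    have hc := (hmom 0 (by simpa) hsph.self_of_nhds 0).continuousAt.norm
    obtain ⟨M, hM⟩ := exists_nat_gt ‖zeroMoment (fun w => P (w, 0)) 0 δ 0‖
    refine ⟨M, ?_⟩
    filter_upwards [hlt, hsph, hc.eventually_lt_const hM] with x h1 h2 h3
    exact_mod_cast ((fiberZeros_hankelDet hδ (hPx x h1) h2).2.1.trans h3.le)
  have hgood := hlt.and (hsph.and hM)
  set h : Fin (M + 1) → X → ℂ :=
    fun k x => hankelDet (zeroMoment (fun w => P (w, x)) 0 δ) k with hdef
  set ψ : X → ℝ := fun x => ∑ᶠ y ∈ fiberStratum g A δ x, |φ (y, x)| with hψdef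
  have hsub := fiberStratum_subset_fiberZeros (g := g) hAI δ
  have hψ0 : Tendsto ψ (𝓝 0) (𝓝 0) := by
    refine Metric.tendsto_nhds.2 fun e he => ?_
    have he' : 0 < e / (M + 1) := by positivity
    obtain ⟨r, hr, hφr⟩ := Metric.eventually_nhds_iff_ball.1
      (eventually_nhdsWithin_iff.1 (Metric.tendsto_nhds.1 hφ0 _ he'))
    have hfar : ∀ᶠ x : X in 𝓝 0, ∀ w ∈ closedBall (0 : ℂ) δ \ ball 0 r, P (w, x) ≠ 0 := by
      refine ((isCompact_closedBall 0 δ).diff isOpen_ball).eventually_forall_of_forall_eventually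
        (P := fun x w => P (w, x) ≠ 0) fun w hw => ?_
      have hw0 : w ≠ 0 := by
        rintro rfl
        exact hw.2 (mem_ball_self hr)
      exact (continuous_swap.tendsto ((0 : X), w)).eventually
        ((hPx 0 (by simpa) w hw.1).self_of_nhds.continuousAt.eventually_ne (hδne w hw.1 hw0))
    filter_upwards [hgood, hfar, ball_mem_nhds (0 : X) hr] with x h1 h2 h3
    have hf := (fiberZeros_hankelDet hδ (hPx x h1.1) h1.2.1).1
    have hfS := hf.subset (hsub x)
    have hcard : hfS.toFinset.card ≤ M := by
      rw [← Set.ncard_eq_toFinset_card _ hfS]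
      exact (Set.ncard_le_ncard (hsub x) hf).trans h1.2.2
    have hle : ψ x ≤ M * (e / (M + 1)) := by
      rw [hψdef]
      simp only
      rw [finsum_mem_eq_finite_toFinset_sum _ hfS]
      refine (Finset.sum_le_card_nsmul _ _ (e / (M + 1)) fun y hy => ?_).trans ?_
      · rw [Set.Finite.mem_toFinset] at hy
        have hyr : y ∈ ball (0 : ℂ) r := by
          by_contra hyr
          exact h2 y ⟨ball_subset_closedBall hy.1, hyr⟩ (hsub x hy).2
        have := hφr (y, x) (by
          rw [mem_ball_zero_iff, Prod.norm_def]
          exact max_lt (mem_ball_zero_iff.1 hyr) (mem_ball_zero_iff.1 h3)) hy.2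
        rw [Real.dist_0_eq_abs] at this
        exact this.le
      · rw [nsmul_eq_mul]
        gcongr
    have hnn : 0 ≤ ψ x := finsum_nonneg fun y => finsum_nonneg fun _ => abs_nonneg _
    rw [Real.dist_0_eq_abs, abs_of_nonneg hnn]
    refine hle.trans_lt ?_
    rw [mul_div_assoc', div_lt_iff₀ (by positivity)]
    nlinarith
  have hψ : ∀ A' : Set (Fin (M + 1)), ∀ᶠ x in 𝓝 0, x ∈ stratum h A' → ψ x = 0 := by
    intro A'
    rw [← eventually_nhdsWithin_iff]
    refine hX _ h A' ψ (fun k => ?_) ?_ (hψ0.mono_left nhdsWithin_le_nhds)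
    · filter_upwards [hgood] with x hx
      exact differentiableAt_hankelDet (hmom x hx.1 hx.2.1) k
    · filter_upwards [hgood, hgood.eventually_nhds] with x hx hxe hxA
      refine isFlatAlong_finsum_fiberStratum hAI hδ
        (fun i w hw => (hball _ (hmem x hx.1 w hw)).mono fun p hp => hp.1.1 i)
        (fun i hi w hw => (hball _ (hmem x hx.1 w hw)).mono fun p hp => hp.1.2 i hi)
        hx.2.1 ?_ (fun y hy => (hball _ (hmem x hx.1 y
          (ball_subset_closedBall hy.1))).self_of_nhds.2 hy.2)
      filter_upwards [mem_nhdsWithin_of_mem_nhds hxe, self_mem_nhdsWithin] with x' hx' hxA'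
      have key : ∀ x₁ x₂ : X, ‖x₁‖ < ε → ‖x₂‖ < ε → (∀ w ∈ sphere 0 δ, P (w, x₁) ≠ 0) →
          (∀ w ∈ sphere 0 δ, P (w, x₂) ≠ 0) → (fiberZeros P δ x₂).ncard ≤ M →
          x₁ ∈ stratum h A' → x₂ ∈ stratum h A' →
          (fiberZeros P δ x₂).ncard ≤ (fiberZeros P δ x₁).ncard := by
        intro x₁ x₂ h1 h2 h1s h2s h2M h1A h2A
        by_contra hlt
        rw [not_le] at hlt
        have e1 := (fiberZeros_hankelDet hδ (hPx x₁ h1) h1s).2.2.2 _ hlt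
        have e2 := (fiberZeros_hankelDet hδ (hPx x₂ h2) h2s).2.2.1
        exact e2 ((h2A ⟨_, Nat.lt_succ_of_le h2M⟩).2 ((h1A ⟨_, Nat.lt_succ_of_le h2M⟩).1 e1))
      exact le_antisymm (key x x' hx.1 hx'.1 hx.2.1 hx'.2.1 hx'.2.2 hxA hxA')
        (key x' x hx'.1 hx.1 hx'.2.1 hx.2.1 hx.2.2 hxA' hxA)
  have hψz : ∀ᶠ x in 𝓝 0, ψ x = 0 := by
    filter_upwards [Filter.eventually_all.2 hψ] with x hx
    exact hx {k | h k x = 0} fun k => Iff.rfl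
  rw [eventually_nhdsWithin_iff]
  filter_upwards [(continuous_snd.tendsto (0 : ℂ × X)).eventually (hψz.and hgood),
    (continuous_fst.tendsto (0 : ℂ × X)).eventually (ball_mem_nhds (0 : ℂ) hδ)]
  rintro ⟨y, x⟩ ⟨h0, h1⟩ hy hyS
  have hfS := (fiberZeros_hankelDet hδ (hPx x h1.1) h1.2.1).1.subset (hsub x)
  simp only [hψdef] at h0
  rw [finsum_mem_eq_finite_toFinset_sum _ hfS,
    Finset.sum_eq_zero_iff_of_nonneg fun _ _ => abs_nonneg _] at h0
  exact abs_eq_zero.1 (h0 y (hfS.mem_toFinset.2 ⟨hy, hyS⟩))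

theorem IsFlatAlong.comp {𝕜 E F : Type*} [NontriviallyNormedField 𝕜] [NormedAddCommGroup E]
    [NormedSpace 𝕜 E] [NormedAddCommGroup F] [NormedSpace 𝕜 F] {φ : E → ℝ} {S : Set E}
    {S' : Set F} {L : F → E} {p : F} (hφ : IsFlatAlong φ S (L p)) (hL : DifferentiableAt 𝕜 L p)
    (hmem : ∀ᶠ z in 𝓝[S'] p, L z ∈ S) : IsFlatAlong (fun z => φ (L z)) S' p := by
  have ht : Tendsto L (𝓝[S'] p) (𝓝[S] (L p)) :=
    tendsto_nhdsWithin_iff.2 ⟨hL.continuousAt.tendsto.mono_left nhdsWithin_le_nhds, hmem⟩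
  exact (IsLittleO.comp_tendsto hφ ht).trans_isBigO (hL.isBigO_sub.mono nhdsWithin_le_nhds)

theorem exists_arc_notMem {Z : Set ℂ} (hZ : Z.Finite) (h1 : (1 : ℂ) ∉ Z) :
    ∃ c ∈ Ioo (0 : ℝ) 1, ∀ s ∈ Ioc (0 : ℝ) 1, (⟨s, c * (s * (1 - s))⟩ : ℂ) ∉ Z := by
  obtain ⟨c, hc, hcZ⟩ := (Ioo_infinite (zero_lt_one (α := ℝ))).exists_notMem_finite
    (hZ.image fun z : ℂ => z.im / (z.re * (1 - z.re)))
  refine ⟨c, hc, fun s hs hsZ => ?_⟩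
  rcases hs.2.eq_or_lt with rfl | hlt
  · refine h1 ?_
    convert hsZ using 1
    apply Complex.ext <;> simp
  · refine hcZ ⟨_, hsZ, ?_⟩
    have : s * (1 - s) ≠ 0 := (mul_pos hs.1 (sub_pos.2 hlt)).ne'
    exact mul_div_cancel_right₀ c this

theorem IsFlatAlong.eventually_eq_zero_of_ne_zero {E : Type*} [NormedAddCommGroup E]
    [NormedSpace ℂ E] {P : E → ℂ} {φ : E → ℝ} {S : Set E}
    (hS : ∀ᶠ x in 𝓝 0, x ∈ S ↔ P x ≠ 0)
    (hP : ∀ᶠ x in 𝓝 0, DifferentiableAt ℂ P x)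
    (hφ : ∀ᶠ x in 𝓝 0, x ∈ S → IsFlatAlong φ S x)
    (hφ0 : Tendsto φ (𝓝[S] 0) (𝓝 0)) :
    ∀ᶠ x in 𝓝[S] 0, φ x = 0 := by
  obtain ⟨R, hR, hball⟩ := Metric.eventually_nhds_iff_ball.1 (hS.and (hP.and hφ))
  rw [eventually_nhdsWithin_iff]
  filter_upwards [ball_mem_nhds (0 : E) (half_pos hR)] with x hx hxS
  rw [mem_ball_zero_iff] at hx
  have hmem : ∀ t ∈ ball (0 : ℂ) 2, t • x ∈ ball (0 : E) R := by
    intro t ht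
    rw [mem_ball_zero_iff] at ht ⊢
    rw [norm_smul]
    nlinarith [norm_nonneg x, norm_nonneg t]
  have han : AnalyticOnNhd ℂ (fun t : ℂ => P (t • x)) (closedBall 0 (3 / 2)) := by
    refine (DifferentiableOn.analyticOnNhd (fun t ht => ?_) isOpen_ball).mono
      (closedBall_subset_ball (by norm_num : (3 / 2 : ℝ) < 2))
    exact (DifferentiableAt.comp t (hball _ (hmem t ht)).2.1
      (by fun_prop)).differentiableWithinAt
  have h1 : P ((1 : ℂ) • x) ≠ 0 := by
    have := hball ((1 : ℂ) • x) (hmem 1 (by simp))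
    rw [one_smul] at this ⊢
    exact this.1.1 hxS
  have hfin := han.finite_zeros_closedBall (a := 1) (by simp; norm_num) h1
  obtain ⟨c, hc, hcZ⟩ := exists_arc_notMem hfin fun h => h1 h.2
  set γ : ℝ → ℂ := fun s => s + (c * (s * (1 - s)) : ℝ) * Complex.I with hγ
  have hγe : ∀ s, γ s = ⟨s, c * (s * (1 - s))⟩ := fun s => by
    apply Complex.ext <;> simp [hγ]
  have hγd : Differentiable ℝ γ := by
    have h1 : Differentiable ℝ (fun s : ℝ => (s : ℂ)) := Complex.ofRealCLM.differentiable
    have h2 : Differentiable ℝ (fun s : ℝ => ((c * (s * (1 - s)) : ℝ) : ℂ)) :=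
      Complex.ofRealCLM.differentiable.comp
        (show Differentiable ℝ (fun s : ℝ => c * (s * (1 - s))) by fun_prop)
    exact h1.add (h2.mul_const _)
  have hγb : ∀ s ∈ Icc (0 : ℝ) 1, ‖γ s‖ ≤ 3 / 2 := by
    intro s hs
    have h2 : 0 ≤ s * (1 - s) := mul_nonneg hs.1 (sub_nonneg.2 hs.2)
    have h3 : c * (s * (1 - s)) ≤ 1 / 2 := by nlinarith [hc.1, hc.2, sq_nonneg (s - 1 / 2)]
    have h4 : 0 ≤ c * (s * (1 - s)) := mul_nonneg hc.1.le h2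
    refine (norm_add_le _ _).trans ?_
    rw [norm_mul, Complex.norm_I, Complex.norm_real, Complex.norm_real, Real.norm_of_nonneg h4,
      Real.norm_of_nonneg hs.1]
    linarith [hs.2]
  have hγR : ∀ s ∈ Icc (0 : ℝ) 1, γ s • x ∈ ball (0 : E) R := fun s hs =>
    hmem _ (mem_ball_zero_iff.2 ((hγb s hs).trans_lt (by norm_num)))
  have hγP : ∀ s ∈ Ioc (0 : ℝ) 1, P (γ s • x) ≠ 0 := by
    intro s hs h0
    refine hcZ s hs ?_
    rw [← hγe]
    exact ⟨mem_closedBall_zero_iff.2 (hγb s ⟨hs.1.le, hs.2⟩), h0⟩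
  have hγx : Differentiable ℝ (fun s => γ s • x) := hγd.smul_const x
  have hγS : ∀ s ∈ Ioc (0 : ℝ) 1, γ s • x ∈ S := fun s hs =>
    (hball _ (hγR s ⟨hs.1.le, hs.2⟩)).1.2 (hγP s hs)
  have hder : ∀ s ∈ Ioc (0 : ℝ) 1, HasDerivAt (fun s => φ (γ s • x)) 0 s := by
    intro s hs
    have hR' := hγR s ⟨hs.1.le, hs.2⟩
    have hflat := (hball _ hR').2.2 (hγS s hs)
    have hev : ∀ᶠ z in 𝓝[univ] s, γ z • x ∈ S := by
      rw [nhdsWithin_univ]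
      have h2 := hγx.continuous.continuousAt.eventually
        ((hball _ hR').2.1.continuousAt.eventually_ne (hγP s hs))
      have h3 := hγx.continuous.continuousAt.eventually (isOpen_ball.mem_nhds hR')
      filter_upwards [h2, h3] with z h2 h3
      exact (hball _ h3).1.2 h2
    have := IsFlatAlong.comp (L := fun s => γ s • x) hflat (hγx s) hev
    rw [IsFlatAlong, nhdsWithin_univ] at this
    rw [hasDerivAt_iff_isLittleO]
    simpa using this
  have hconst : ∀ s ∈ Ioc (0 : ℝ) 1, φ (γ s • x) = φ x := by
    intro s hs
    have := constant_of_has_deriv_right_zero (f := fun s => φ (γ s • x)) (a := s) (b := 1)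
      (fun t ht => (hder t ⟨hs.1.trans_le ht.1, ht.2⟩).continuousAt.continuousWithinAt)
      (fun t ht => (hder t ⟨hs.1.trans_le ht.1, ht.2.le⟩).hasDerivWithinAt) 1
      (right_mem_Icc.2 hs.2)
    simpa [hγ] using this.symm
  have ht : Tendsto (fun s => φ (γ s • x)) (𝓝[Ioc 0 1] (0 : ℝ)) (𝓝 0) := by
    refine hφ0.comp (tendsto_nhdsWithin_iff.2 ⟨?_, ?_⟩)
    · have := hγx.continuous.tendsto 0
      simp only [hγ] at this
      simp only [hγ]
      refine Tendsto.mono_left ?_ nhdsWithin_le_nhds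
      simpa using this
    · filter_upwards [self_mem_nhdsWithin] with s hs using hγS s hs
  have : (𝓝[Ioc 0 1] (0 : ℝ)).NeBot := by
    rw [nhdsWithin_Ioc_eq_nhdsGT zero_lt_one]
    infer_instance
  refine tendsto_nhds_unique (tendsto_const_nhds.congr' ?_) ht
  filter_upwards [self_mem_nhdsWithin] with s hs using (hconst s hs).symm

theorem eq_zero_of_eventually_line {E : Type*} [NormedAddCommGroup E] [NormedSpace ℂ E]
    {h : E → ℂ} {R : ℝ} (hd : ∀ z ∈ ball 0 R, DifferentiableAt ℂ h z) {a x : E}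
    (ha : a ∈ ball 0 R) (hx : x ∈ ball 0 R) (h0 : ∀ᶠ t in 𝓝 (0 : ℂ), h (a + t • (x - a)) = 0) :
    h x = 0 := by
  set L : ℂ → E := fun t => a + t • (x - a) with hL
  have hLc : Continuous L := by fun_prop
  have hopen : IsOpen (L ⁻¹' ball 0 R) := isOpen_ball.preimage hLc
  have hconv : Convex ℝ (L ⁻¹' ball 0 R) := by
    intro s hs t ht p q hp hq hpq
    have : L (p • s + q • t) = p • L s + q • L t := by
      calc L (p • s + q • t) = (p • a + q • a) + (p • s + q • t) • (x - a) := by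
            rw [← add_smul, hpq, one_smul]
        _ = p • L s + q • L t := by
            simp only [hL, smul_add, add_smul, smul_assoc]
            abel
    rw [mem_preimage, this]
    exact convex_ball (0 : E) R hs ht hp hq hpq
  have han : AnalyticOnNhd ℂ (fun t => h (L t)) (L ⁻¹' ball 0 R) :=
    DifferentiableOn.analyticOnNhd (fun t ht =>
      (DifferentiableAt.comp t (hd _ ht) (by fun_prop)).differentiableWithinAt) hopen
  have := han.eqOn_zero_of_preconnected_of_eventuallyEq_zero hconv.isPreconnected
    (z₀ := 0) (by simpa [hL] using ha) h0 (x := 1) (by simpa [hL] using hx)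
  simpa [hL] using this

theorem not_eventually_mul_eq_zero {E : Type*} [NormedAddCommGroup E] [NormedSpace ℂ E]
    {h₁ h₂ : E → ℂ} (hd₁ : ∀ᶠ x in 𝓝 0, DifferentiableAt ℂ h₁ x)
    (hd₂ : ∀ᶠ x in 𝓝 0, DifferentiableAt ℂ h₂ x) (hne₁ : ¬ ∀ᶠ x in 𝓝 0, h₁ x = 0)
    (hne₂ : ¬ ∀ᶠ x in 𝓝 0, h₂ x = 0) : ¬ ∀ᶠ x in 𝓝 0, h₁ x * h₂ x = 0 := by
  intro h0
  obtain ⟨R, hR, hball⟩ := Metric.eventually_nhds_iff_ball.1 (hd₁.and (hd₂.and h0))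
  obtain ⟨a, ha, ha0⟩ : ∃ a ∈ ball (0 : E) R, h₁ a ≠ 0 := by
    by_contra! hcon
    exact hne₁ (Filter.mem_of_superset (ball_mem_nhds 0 hR) hcon)
  have hz : ∀ᶠ x in 𝓝 a, h₂ x = 0 := by
    filter_upwards [(hball a ha).1.continuousAt.eventually_ne ha0, isOpen_ball.mem_nhds ha]
      with x h1 h2
    exact (mul_eq_zero.1 (hball x h2).2.2).resolve_left h1
  refine hne₂ (Filter.mem_of_superset (ball_mem_nhds 0 hR) fun x hx => ?_)
  refine eq_zero_of_eventually_line (fun z hz => (hball z hz).2.1) ha hx ?_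
  have hc : ContinuousAt (fun t : ℂ => a + t • (x - a)) 0 := by fun_prop
  exact hc.eventually (by simpa using hz)

theorem not_eventually_prod_eq_zero {E ι : Type*} [NormedAddCommGroup E] [NormedSpace ℂ E]
    {g : ι → E → ℂ} (hd : ∀ i, ∀ᶠ x in 𝓝 0, DifferentiableAt ℂ (g i) x) (I : Finset ι)
    (hne : ∀ i ∈ I, ¬ ∀ᶠ x in 𝓝 0, g i x = 0) : ¬ ∀ᶠ x in 𝓝 0, ∏ i ∈ I, g i x = 0 := by
  classical
  induction I using Finset.induction_on with
  | empty => simpa using (inferInstance : NeBot (𝓝 (0 : E))).ne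
  | insert i I hi ih =>
    simp only [Finset.prod_insert hi]
    refine not_eventually_mul_eq_zero (hd i) ?_ (hne i (Finset.mem_insert_self i I))
      (ih fun j hj => hne j (Finset.mem_insert_of_mem hj))
    filter_upwards [(Filter.eventually_all_finset I).2 fun j _ => hd j] with x hx
    exact differentiableAt_prod hx

theorem flatFunctionsVanish_of_finrank (n : ℕ) : ∀ (E : Type) [NormedAddCommGroup E]
    [NormedSpace ℂ E] [FiniteDimensional ℂ E], Module.finrank ℂ E = n →
      FlatFunctionsVanish E := by
  classical
  induction n using Nat.strong_induction_on with
  | _ n ih =>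
  intro E _ _ _ hn ι _ g A φ hg hφ hφ0
  have := Fintype.ofFinite ι
  set I : Finset ι := Finset.univ.filter fun i => ¬ ∀ᶠ x in 𝓝 0, g i x = 0 with hI
  have hIc : ∀ i ∉ I, ∀ᶠ x in 𝓝 0, g i x = 0 := fun i hi => by simpa [hI] using hi
  have hgI : ∀ᶠ x in 𝓝 0, ∀ i ∉ I, g i x = 0 := by
    refine Filter.eventually_all.2 fun i => ?_
    by_cases hi : i ∈ I
    · simp [hi]
    · filter_upwards [hIc i hi] with x hx _ using hx
  have hPd : ∀ᶠ x in 𝓝 0, DifferentiableAt ℂ (fun x => ∏ i ∈ I, g i x) x := by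
    filter_upwards [Filter.eventually_all.2 hg] with x hx
    exact differentiableAt_prod fun i _ => hx i
  by_cases hempty : ∃ i ∉ I, i ∉ A
  · obtain ⟨i, hi, hiA⟩ := hempty
    filter_upwards [mem_nhdsWithin_of_mem_nhds (hIc i hi), self_mem_nhdsWithin] with x h1 h2
    exact absurd ((h2 i).1 h1) hiA
  push Not at hempty
  by_cases hAI : ∃ i ∈ I, i ∈ A
  · by_cases hP0 : ∏ i ∈ I, g i 0 = 0
    · obtain ⟨R, hR, hball⟩ := Metric.eventually_nhds_iff_ball.1 hPd
      obtain ⟨v, hv, hv0⟩ : ∃ v ∈ ball (0 : E) R, ∏ i ∈ I, g i v ≠ 0 := by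
        by_contra! hcon
        exact not_eventually_prod_eq_zero hg I (fun i hi => by simpa [hI] using hi)
          (Filter.mem_of_superset (ball_mem_nhds 0 hR) hcon)
      have hvne : v ≠ 0 := by
        rintro rfl
        exact hv0 hP0
      obtain ⟨ℓ, hℓ⟩ := SeparatingDual.exists_eq_one (R := ℂ) hvne
      have hinv : Function.RightInverse (ContinuousLinearMap.toSpanSingleton ℂ v) ℓ := fun t => by
        simp [hℓ]
      set e := ContinuousLinearEquiv.equivOfRightInverse ℓ
        (ContinuousLinearMap.toSpanSingleton ℂ v) hinv
      have hX : FlatFunctionsVanish ℓ.ker := by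
        refine ih _ ?_ ℓ.ker rfl
        rw [← hn]
        refine Submodule.finrank_lt fun htop => ?_
        have : v ∈ ℓ.ker := htop ▸ Submodule.mem_top
        rw [LinearMap.mem_ker] at this
        exact one_ne_zero (hℓ.symm.trans this)
      have : ProperSpace ℓ.ker := FiniteDimensional.proper ℂ _
      have hte : Tendsto e.symm (𝓝 0) (𝓝 0) := by
        simpa using e.symm.continuous.tendsto 0
      have hset : stratum (fun i p => g i (e.symm p)) A = e.symm ⁻¹' stratum g A := rfl
      have hte' : Tendsto e.symm (𝓝[stratum (fun i p => g i (e.symm p)) A] 0)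
          (𝓝[stratum g A] 0) :=
        tendsto_nhdsWithin_iff.2 ⟨hte.mono_left nhdsWithin_le_nhds, self_mem_nhdsWithin⟩
      have key := hX.prod_of_fiber_ne_zero (g := fun i p => g i (e.symm p)) hAI
        (φ := fun p => φ (e.symm p))
        (fun i => (hte.eventually (hg i)).mono fun p hp =>
          DifferentiableAt.comp p hp e.symm.differentiableAt)
        (fun i hi => hte.eventually (hIc i hi)) ?_
        ((hte.eventually hφ).mono fun p hp hpS => (hp hpS).comp (𝕜 := ℂ)
          e.symm.differentiableAt self_mem_nhdsWithin) (hφ0.comp hte')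
      · have hte2 : Tendsto e (𝓝[stratum g A] 0)
            (𝓝[stratum (fun i p => g i (e.symm p)) A] 0) := by
          refine tendsto_nhdsWithin_iff.2 ⟨?_, ?_⟩
          · have : Tendsto e (𝓝 0) (𝓝 0) := by simpa using e.continuous.tendsto 0
            exact this.mono_left nhdsWithin_le_nhds
          · filter_upwards [self_mem_nhdsWithin] with x hx
            simpa [hset] using hx
        simpa using hte2.eventually key
      · intro hev
        refine hv0 (eq_zero_of_eventually_line hball (mem_ball_self hR) hv ?_)
        filter_upwards [hev] with t ht
        simpa [e] using ht
    · obtain ⟨i, hi, hiA⟩ := hAI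
      rw [Finset.prod_eq_zero_iff] at hP0
      have hne : g i 0 ≠ 0 := fun h => hP0 ⟨i, hi, h⟩
      filter_upwards [mem_nhdsWithin_of_mem_nhds
        ((hg i).self_of_nhds.continuousAt.eventually_ne hne), self_mem_nhdsWithin] with x h1 h2
      exact absurd ((h2 i).2 hiA) h1
  · refine IsFlatAlong.eventually_eq_zero_of_ne_zero (P := fun x => ∏ i ∈ I, g i x)
      ?_ hPd hφ hφ0
    push Not at hAI
    filter_upwards [hgI] with x hx
    rw [Finset.prod_ne_zero_iff]
    refine ⟨fun h i hi h0 => hAI i hi ((h i).1 h0), fun h i => ?_⟩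
    by_cases hi : i ∈ I
    · simp [h i hi, hAI i hi]
    · simp [hx i hi, hempty i hi]

theorem eventually_eq_of_fderiv_eq_zero {n : ℕ} {f : EuclideanSpace ℂ (Fin n) → ℂ}
    {p : EuclideanSpace ℂ (Fin n)} (hf : AnalyticAt ℂ f p) :
    ∀ᶠ q in 𝓝 p, fderiv ℂ f q = 0 → f q = f p := by
  set b := EuclideanSpace.basisFun (Fin n) ℂ
  have hb : ∀ T : EuclideanSpace ℂ (Fin n) →L[ℂ] ℂ, (∀ i, T (b i) = 0) ↔ T = 0 := by
    refine fun T => ⟨fun h => ?_, fun h => by simp [h]⟩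
    exact ContinuousLinearMap.coe_injective (b.toBasis.ext fun i => by simpa using h i)
  set g : Fin n → EuclideanSpace ℂ (Fin n) → ℂ := fun i x => fderiv ℂ f (p + x) (b i) with hgdef
  have hS : ∀ x, x ∈ stratum g univ ↔ fderiv ℂ f (p + x) = 0 := fun x => by
    rw [← hb]
    simp [stratum, hgdef]
  have ht : Tendsto (fun x => p + x) (𝓝 0) (𝓝 p) := by
    have : Continuous fun x => p + x := by fun_prop
    simpa using this.tendsto 0
  have han := ht.eventually hf.eventually_analyticAt
  have hvan := flatFunctionsVanish_of_finrank _ (EuclideanSpace ℂ (Fin n)) rfl (Fin n) g univ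
    (fun x => ‖f (p + x) - f p‖) (fun i => ?_) ?_ ?_
  · have ht2 : Tendsto (fun q => q - p) (𝓝 p) (𝓝 0) := by
      have : Continuous fun q => q - p := by fun_prop
      simpa using this.tendsto p
    rw [eventually_nhdsWithin_iff] at hvan
    filter_upwards [ht2.eventually hvan] with q hq hq0
    have := hq ((hS _).2 (by simpa using hq0))
    simpa [sub_eq_zero] using this
  · filter_upwards [han] with x hx
    have h1 : DifferentiableAt ℂ (fun x => fderiv ℂ f (p + x)) x :=
      DifferentiableAt.comp x hx.fderiv.differentiableAt (by fun_prop)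
    exact h1.clm_apply (differentiableAt_const _)
  · filter_upwards [han] with x hx hxS
    have hd := hx.differentiableAt.hasFDerivAt
    rw [(hS x).1 hxS, hasFDerivAt_iff_isLittleO] at hd
    have htx : Tendsto (fun z => p + z) (𝓝 x) (𝓝 (p + x)) := by
      have : Continuous fun x => p + x := by fun_prop
      exact this.tendsto x
    have h1 := hd.comp_tendsto htx
    refine IsLittleO.mono ?_ nhdsWithin_le_nhds
    refine IsBigO.trans_isLittleO (isBigO_of_le _ fun z => ?_)
      (h1.trans_isBigO (isBigO_of_le _ fun z => ?_))
    · simpa using abs_norm_sub_norm_le (f (p + z) - f p) (f (p + x) - f p)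
    · simp
  · refine Tendsto.mono_left ?_ nhdsWithin_le_nhds
    have := ((hf.continuousAt.tendsto.comp ht).sub_const (f p)).norm
    simpa using this

/- STATEMENT 0: If f is complex analytic on an open neighborhood U of the origin in
ℂ^{n+1} (n ≥ 1), then the restriction of f to its critical locus
Σf = {z ∈ U : Df(z) = 0}, with the subspace topology, is locally constant;
in particular, for every p ∈ Σf there is an open neighborhood V ⊆ U of p such that
every q ∈ V with Df(q) = 0 satisfies f(q) = f(p), and hence if f(p) = 0 then
Σf ∩ V ⊆ f⁻¹(0). -/
theorem stmt_0 (n : ℕ) (hn : 1 ≤ n)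
    (U : Set (EuclideanSpace ℂ (Fin (n + 1)))) (hU : IsOpen U)
    (h0U : (0 : EuclideanSpace ℂ (Fin (n + 1))) ∈ U)
    (f : EuclideanSpace ℂ (Fin (n + 1)) → ℂ)
    (hf : ∀ z ∈ U, AnalyticAt ℂ f z) :
    IsLocallyConstant (Set.restrict {z ∈ U | fderiv ℂ f z = 0} f) ∧
    ∀ p ∈ {z ∈ U | fderiv ℂ f z = 0},
      ∃ V : Set (EuclideanSpace ℂ (Fin (n + 1))),
        IsOpen V ∧ p ∈ V ∧ V ⊆ U ∧
        (∀ q ∈ V, fderiv ℂ f q = 0 → f q = f p) ∧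
        (f p = 0 → ∀ q ∈ V, fderiv ℂ f q = 0 → f q = 0) := by
  constructor
  · rw [IsLocallyConstant.iff_eventually_eq]
    rintro ⟨p, hpU, hp⟩
    filter_upwards [continuous_subtype_val.continuousAt.eventually
      (eventually_eq_of_fderiv_eq_zero (hf p hpU))] with q hq
    exact hq q.2.2
  · rintro p ⟨hpU, -⟩
    obtain ⟨V, hV, hVo, hpV⟩ :=
      _root_.eventually_nhds_iff.1 (eventually_eq_of_fderiv_eq_zero (hf p hpU))
    exact ⟨V ∩ U, hVo.inter hU, ⟨hpV, hpU⟩, inter_subset_right, fun q hq => hV q hq.1,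
      fun h0 q hq hq0 => (hV q hq.1 hq0).trans h0⟩
end

section
/- Suppose f satisfies central isolation, i.e., 0 is an isolated point of the set {z ∈ U : z_0 = ⋯ = z_{s−1} = 0 and ∂f/∂z_j(z) = 0 for all s ≤ j ≤ n}. Then there is an open neighborhood W ⊆ U of 0 such that for every a ∈ ℂ^s the set {z ∈ W : z_j = a_j for all 0 ≤ j ≤ s−1, and ∂f/∂z_j(z) = 0 for all s ≤ j ≤ n} is finite. (In particular, if the central slice function f_0 has an isolated critical point at 0, then for every q near 0 the slice function f_q has only isolated critical points near 0.) -/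
/-- ℂ^{n+1} identified with ℂ^s × ℂ^{n+1-s}. -/
abbrev Csp (n s : ℕ) : Type := (Fin s → ℂ) × (Fin (n + 1 - s) → ℂ)

/-- The partial derivatives ∂f/∂z_j for s ≤ j ≤ n all vanish at z. -/
def PartialsVanish (n s : ℕ) (f : Csp n s → ℂ) (z : Csp n s) : Prop :=
  ∀ j : Fin (n + 1 - s), fderiv ℂ f z (0, Pi.single j 1) = 0

/-- Central isolation: 0 is an isolated point of
{z ∈ U : z' = 0 and ∂f/∂z_j(z) = 0 for all s ≤ j ≤ n}. -/
def CentralIsolation (n s : ℕ) (f : Csp n s → ℂ) (U : Set (Csp n s)) : Prop :=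
  ∃ W : Set (Csp n s), IsOpen W ∧ (0 : Csp n s) ∈ W ∧
    ∀ z ∈ U ∩ W, z.1 = 0 → PartialsVanish n s f z → z = 0

open Filter Topology Metric
open scoped ContDiff Real

/-- Elementary symmetric functions are universal polynomials in power sums. -/
theorem exists_esymm_eq_eval_psum (k : ℕ) : ∃ P : MvPolynomial ℕ ℂ,
    ∀ (ι : Type) [Fintype ι] (v : ι → ℂ), MvPolynomial.eval v (MvPolynomial.esymm ι ℂ k) =
      MvPolynomial.eval (fun m => ∑ i, v i ^ m) P := by
  induction k using Nat.strong_induction_on with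
  | _ k ih =>
    rcases Nat.eq_zero_or_pos k with rfl | hk
    · exact ⟨1, fun ι _ v => by simp⟩
    · choose! P hP using ih
      refine ⟨MvPolynomial.C ((k : ℂ)⁻¹) * ((-1) ^ (k + 1) *
        ∑ a ∈ Finset.HasAntidiagonal.antidiagonal k with a.1 < k, (-1) ^ a.1 * P a.1 * MvPolynomial.X a.2), ?_⟩
      intro ι _ v
      have hk' : (k : ℂ) ≠ 0 := by exact_mod_cast hk.ne'
      have h := congrArg (MvPolynomial.eval v) (MvPolynomial.mul_esymm_eq_sum ι ℂ k)
      simp only [map_mul, map_natCast, map_pow, map_neg, map_one, map_sum] at h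
      simp only [map_mul, map_pow, map_neg, map_one, map_sum, MvPolynomial.eval_C,
        MvPolynomial.eval_X]
      rw [eq_inv_mul_iff_mul_eq₀ hk', h]
      congr 1
      refine Finset.sum_congr rfl fun a ha => ?_
      rw [hP a.1 (Finset.mem_filter.1 ha).2 ι v]
      simp [MvPolynomial.psum]

theorem exists_prod_eq_eval_psum (d : ℕ) : ∃ P : MvPolynomial ℕ ℂ,
    ∀ (ι : Type) [Fintype ι] (v : ι → ℂ), Fintype.card ι = d →
      ∏ i, v i = MvPolynomial.eval (fun m => ∑ i, v i ^ m) P := by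
  obtain ⟨P, hP⟩ := exists_esymm_eq_eval_psum d
  refine ⟨P, fun ι _ v hd => ?_⟩
  subst hd
  rw [← hP, MvPolynomial.esymm, ← Finset.card_univ, Finset.powersetCard_self]
  simp

theorem ContDiffAt.mvPolynomial_eval {Y : Type} [NormedAddCommGroup Y] [NormedSpace ℂ Y]
    {σ : Type} {n : WithTop ℕ∞} {s : Y → σ → ℂ} {y : Y}
    (hs : ∀ k, ContDiffAt ℂ n (fun x => s x k) y) (P : MvPolynomial σ ℂ) :
    ContDiffAt ℂ n (fun x => MvPolynomial.eval (s x) P) y := by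
  induction P using MvPolynomial.induction_on with
  | C a => simpa using contDiffAt_const
  | add p q hp hq => simpa using hp.add hq
  | mul_X p k hp => simpa using hp.mul (hs k)

theorem AnalyticOnNhd.finite_zeros_closedBall_s1 {p : ℂ → ℂ} {r : ℝ} (hr : 0 < r)
    (hp : AnalyticOnNhd ℂ p (closedBall 0 r)) (hp0 : ∀ z ∈ sphere (0 : ℂ) r, p z ≠ 0) :
    {z ∈ closedBall (0 : ℂ) r | p z = 0}.Finite := by
  by_contra hinf
  obtain ⟨x, hx, hacc⟩ := (Set.not_finite.1 hinf |> fun h => (Set.Infinite.exists_accPt_of_subset_isCompact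
    (K := closedBall (0 : ℂ) r) h (isCompact_closedBall _ _) fun z hz => hz.1))
  have hfreq : ∃ᶠ z in 𝓝[≠] x, p z = 0 :=
    (accPt_iff_frequently_nhdsNE.1 hacc).mono fun z hz => hz.2
  have := hp.eqOn_zero_of_preconnected_of_frequently_eq_zero
    (convex_closedBall (0 : ℂ) r).isPreconnected hx hfreq
  have hmem : (r : ℂ) ∈ sphere (0 : ℂ) r := by simp [abs_of_pos hr]
  exact hp0 _ hmem (this (sphere_subset_closedBall hmem))

theorem AnalyticOnNhd.exists_factorization {K : Set ℂ} : ∀ (k : ℕ) {p : ℂ → ℂ},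
    AnalyticOnNhd ℂ p K → {z ∈ K | p z = 0}.Finite → {z ∈ K | p z = 0}.ncard = k →
    (∀ z ∈ K, ∃ᶠ x in 𝓝 z, p x ≠ 0) →
    ∃ (ι : Type) (_ : Fintype ι) (v : ι → ℂ) (u : ℂ → ℂ), (∀ i, v i ∈ K) ∧
      AnalyticOnNhd ℂ u K ∧ (∀ z ∈ K, u z ≠ 0) ∧ ∀ z, p z = (∏ i, (z - v i)) * u z := by
  intro k
  induction k with
  | zero =>
    intro p hp hfin hcard _
    refine ⟨Empty, inferInstance, Empty.elim, p, fun i => i.elim, hp, fun z hz h0 => ?_, by simp⟩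
    have := (Set.ncard_eq_zero hfin).1 hcard
    exact this.subset ⟨hz, h0⟩
  | succ k ih =>
    intro p hp hfin hcard hne
    obtain ⟨a, ha⟩ := Set.nonempty_of_ncard_ne_zero (by omega : {z ∈ K | p z = 0}.ncard ≠ 0)
    obtain ⟨P, hP⟩ := hp a ha.1
    have hP0 : P ≠ 0 := fun h => hne a ha.1 <| by
      simpa using hP.locally_zero_iff.2 h
    set m := P.order
    set q := (Function.swap dslope a)^[m] p with hq
    have hpq : ∀ z, p z = (z - a) ^ m * q z := hP.eq_pow_order_mul_iterate_dslope
    have hqa : q a ≠ 0 := hP.iterate_dslope_fslope_ne_zero hP0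
    have hm : m ≠ 0 := by
      intro h
      have := hpq a
      rw [ha.2, h] at this
      simp at this
      exact hqa this.symm
    have hqan : AnalyticOnNhd ℂ q K := by
      intro z hz
      by_cases hza : z = a
      · subst hza
        exact ⟨_, hP.has_fpower_series_iterate_dslope_fslope m⟩
      · have h1 : AnalyticAt ℂ (fun x => p x / (x - a) ^ m) z :=
          (hp z hz).div (by fun_prop) (pow_ne_zero _ (sub_ne_zero.2 hza))
        refine h1.congr ?_
        filter_upwards [isOpen_ne.mem_nhds hza] with x hx
        rw [hpq x, mul_div_cancel_left₀ _ (pow_ne_zero _ (sub_ne_zero.2 hx))]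
    have hset : {z ∈ K | q z = 0} = {z ∈ K | p z = 0} \ {a} := by
      ext z
      simp only [Set.mem_ofPred_eq, Set.mem_sdiff, Set.mem_singleton_iff]
      constructor
      · rintro ⟨hz, h0⟩
        exact ⟨⟨hz, by rw [hpq, h0, mul_zero]⟩, fun h => hqa (h ▸ h0)⟩
      · rintro ⟨⟨hz, h0⟩, hza⟩
        refine ⟨hz, ?_⟩
        rw [hpq] at h0
        exact (mul_eq_zero.1 h0).resolve_left (pow_ne_zero _ (sub_ne_zero.2 hza))
    obtain ⟨ι, hι, v, u, hv, hu, hu0, hfac⟩ := ih hqan (hset ▸ hfin.sdiff)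
      (by rw [hset, Set.ncard_sdiff_singleton_of_mem ha, hcard]; rfl)
      (fun z hz => (hne z hz).mono fun x hx h0 => hx (by rw [hpq, h0, mul_zero]))
    refine ⟨ι ⊕ Fin m, inferInstance, Sum.elim v fun _ => a, u, ?_, hu, hu0, fun z => ?_⟩
    · rintro (i | i)
      exacts [hv i, ha.1]
    · rw [Fintype.prod_sum_type, hpq z, hfac z]
      simp
      ring

/-- The generalized argument principle on a disc. -/
theorem AnalyticOnNhd.exists_roots_circleIntegral {p : ℂ → ℂ} {r : ℝ} (hr : 0 < r)
    (hp : AnalyticOnNhd ℂ p (closedBall 0 r)) (hp0 : ∀ z ∈ sphere (0 : ℂ) r, p z ≠ 0) :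
    ∃ (ι : Type) (_ : Fintype ι) (v : ι → ℂ),
      (∀ z, (∃ i, v i = z) ↔ z ∈ closedBall 0 r ∧ p z = 0) ∧
      ∀ q : ℂ → ℂ, AnalyticOnNhd ℂ q (closedBall 0 r) →
        (2 * π * Complex.I)⁻¹ * (∮ z in C(0, r), q z * (deriv p z / p z)) = ∑ i, q (v i) := by
  have hfin := hp.finite_zeros_closedBall_s1 hr hp0
  obtain ⟨ι, hι, v, u, hv, hu, hu0, hfac⟩ := AnalyticOnNhd.exists_factorization _ hp hfin rfl
    (by
      intro z hz hev
      have hfreq : ∃ᶠ z in 𝓝[≠] z, p z = 0 :=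
        (Filter.Eventually.filter_mono nhdsWithin_le_nhds hev).frequently.mono fun x hx =>
          not_not.1 hx
      have := hp.eqOn_zero_of_preconnected_of_frequently_eq_zero
        (convex_closedBall (0 : ℂ) r).isPreconnected hz hfreq
      have hmem : (r : ℂ) ∈ sphere (0 : ℂ) r := by simp [abs_of_pos hr]
      exact hp0 _ hmem (this (sphere_subset_closedBall hmem)))
  have hpv : ∀ i, p (v i) = 0 := fun i => by
    rw [hfac, Finset.prod_eq_zero (Finset.mem_univ i) (sub_self _), zero_mul]
  refine ⟨ι, hι, v, fun z => ⟨?_, fun ⟨hz, h0⟩ => ?_⟩, fun q hq => ?_⟩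
  · rintro ⟨i, rfl⟩
    exact ⟨hv i, hpv i⟩
  · rw [hfac] at h0
    obtain ⟨i, -, hi⟩ := Finset.prod_eq_zero_iff.1 ((mul_eq_zero.1 h0).resolve_right (hu0 z hz))
    exact ⟨i, (sub_eq_zero.1 hi).symm⟩
  have hvball : ∀ i, v i ∈ ball (0 : ℂ) r := fun i => by
    refine mem_ball.2 (lt_of_le_of_ne (mem_closedBall.1 (hv i)) fun h => hp0 _ h (hpv i))
  have hsub : ∀ z ∈ sphere (0 : ℂ) r, ∀ i, z - v i ≠ 0 := fun z hz i h => by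
    rw [sub_eq_zero] at h
    exact hp0 z hz (h ▸ hpv i)
  have hlog : ∀ z ∈ sphere (0 : ℂ) r, q z * (deriv p z / p z) =
      (∑ i, (z - v i)⁻¹ * q z) + q z * (deriv u z / u z) := by
    intro z hz
    have hz' := sphere_subset_closedBall hz
    have h1 : deriv p z / p z = logDeriv (fun z => (∏ i, (z - v i)) * u z) z := by
      rw [← funext hfac]; rfl
    rw [h1, logDeriv_mul (f := fun z => ∏ i, (z - v i)) z
      (Finset.prod_ne_zero_iff.2 fun i _ => hsub z hz i) (hu0 z hz')
      (by fun_prop) (hu z hz').differentiableAt]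
    have h2 := logDeriv_prod (s := Finset.univ) (f := fun i z => z - v i) (x := z)
      (fun i _ => hsub z hz i) (fun i _ => by fun_prop)
    rw [h2, mul_add, Finset.mul_sum]
    congr 1
    refine Finset.sum_congr rfl fun i _ => ?_
    rw [logDeriv_apply]
    simp [mul_comm]
  rw [circleIntegral.integral_congr hr.le hlog]
  have hqc : ContinuousOn q (sphere 0 r) := hq.continuousOn.mono sphere_subset_closedBall
  have hint : ∀ i ∈ Finset.univ, CircleIntegrable (fun z => (z - v i)⁻¹ * q z) 0 r := fun i _ =>
    (((continuousOn_id.sub continuousOn_const).inv₀ fun z hz => hsub z hz i).mul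
      hqc).circleIntegrable hr.le
  have hquan : AnalyticOnNhd ℂ (fun z => q z * (deriv u z / u z)) (closedBall 0 r) :=
    fun z hz => (hq z hz).mul ((hu z hz).deriv.div (hu z hz) (hu0 z hz))
  have hcint : CircleIntegrable (fun z => q z * (deriv u z / u z)) 0 r :=
    (hquan.continuousOn.mono sphere_subset_closedBall).circleIntegrable hr.le
  have hzero : (∮ z in C(0, r), q z * (deriv u z / u z)) = 0 :=
    Complex.circleIntegral_eq_zero_of_differentiable_on_off_countable hr.le
      Set.countable_empty hquan.continuousOn
      fun z hz => (hquan z (ball_subset_closedBall hz.1)).differentiableAt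
  rw [circleIntegral.integral_add (CircleIntegrable.fun_sum _ hint) hcint, hzero, add_zero,
    circleIntegral.integral_fun_sum hint, Finset.mul_sum]
  refine Finset.sum_congr rfl fun i _ => ?_
  have := (DifferentiableOn.diffContOnCl (f := q) (s := ball 0 r) (by
    rw [closure_ball _ hr.ne']
    exact hq.differentiableOn)).circleIntegral_sub_inv_smul (hvball i)
  simp only [smul_eq_mul] at this
  rw [this, inv_mul_cancel_left₀ Complex.two_pi_I_ne_zero]

theorem IsCompact.exists_eventually_norm_le {Y G : Type} [TopologicalSpace Y]
    [NormedAddCommGroup G] {K : Set ℂ} (hK : IsCompact K) {F : Y × ℂ → G} {y₀ : Y}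
    (hF : ∀ w ∈ K, ContinuousAt F (y₀, w)) :
    ∃ C : ℝ, ∀ᶠ y in 𝓝 y₀, ∀ w ∈ K, ‖F (y, w)‖ ≤ C := by
  have hc : ContinuousOn (fun w => ‖F (y₀, w)‖) K := fun w hw =>
    ((hF w hw).norm.comp (f := fun w => (y₀, w)) (by fun_prop)).continuousWithinAt
  obtain ⟨C, hC⟩ := (hK.image_of_continuousOn hc).bddAbove
  refine ⟨C + 1, hK.eventually_forall_of_forall_eventually
    (P := fun y w => ‖F (y, w)‖ ≤ C + 1) fun w hw => ?_⟩
  have : ‖F (y₀, w)‖ < C + 1 := (hC ⟨w, hw, rfl⟩).trans_lt (lt_add_one C)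
  exact ((hF w hw).norm.eventually_lt_const this).mono fun z hz => hz.le

theorem ContinuousAt.circleMap_slice {Y G : Type} [TopologicalSpace Y]
    [NormedAddCommGroup G] [NormedSpace ℂ G] {F : Y × ℂ → G} {y : Y} {r : ℝ}
    (hr : 0 ≤ r) (hF : ∀ w ∈ sphere (0 : ℂ) r, ContinuousAt F (y, w)) :
    Continuous fun θ => deriv (circleMap 0 r) θ • F (y, circleMap 0 r θ) := by
  refine Continuous.smul ?_ ?_
  · rw [show deriv (circleMap 0 r) = fun θ => circleMap 0 r θ * Complex.I from
      funext fun θ => by simp [deriv_circleMap]]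
    fun_prop
  · exact continuous_iff_continuousAt.2 fun θ =>
      ContinuousAt.comp (f := fun θ => (y, circleMap 0 r θ))
        (hF _ (circleMap_mem_sphere 0 hr θ)) (by fun_prop)

theorem continuousAt_circleIntegral {Y G : Type} [TopologicalSpace Y] [FirstCountableTopology Y]
    [NormedAddCommGroup G] [NormedSpace ℂ G] {F : Y × ℂ → G} {y₀ : Y} {r : ℝ}
    (hr : 0 ≤ r) (hF : ∀ w ∈ sphere (0 : ℂ) r, ∀ᶠ z in 𝓝 (y₀, w), ContinuousAt F z) :
    ContinuousAt (fun y => ∮ w in C(0, r), F (y, w)) y₀ := by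
  have hev : ∀ᶠ y in 𝓝 y₀, ∀ w ∈ sphere (0 : ℂ) r, ContinuousAt F (y, w) :=
    (isCompact_sphere 0 r).eventually_forall_of_forall_eventually
      (P := fun y w => ContinuousAt F (y, w)) hF
  obtain ⟨C, hC⟩ := (isCompact_sphere (0 : ℂ) r).exists_eventually_norm_le hev.self_of_nhds
  unfold circleIntegral
  refine intervalIntegral.continuousAt_of_dominated_interval (bound := fun _ => r * C)
    (hev.mono fun y hy => (ContinuousAt.circleMap_slice hr hy).aestronglyMeasurable)
    (hC.mono fun y hy => .of_forall fun θ _ => ?_) (by simp) (.of_forall fun θ _ => ?_)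
  · rw [norm_smul]
    have : ‖deriv (circleMap 0 r) θ‖ = r := by simp [deriv_circleMap, abs_of_nonneg hr]
    rw [this]
    exact mul_le_mul_of_nonneg_left (hy _ (circleMap_mem_sphere 0 hr θ)) hr
  · exact continuousAt_const.smul (ContinuousAt.comp (f := fun y => (y, circleMap 0 r θ))
      (hev.self_of_nhds _ (circleMap_mem_sphere 0 hr θ)) (by fun_prop))

theorem hasFDerivAt_circleIntegral {Y G : Type} [NormedAddCommGroup Y] [NormedSpace ℂ Y]
    [NormedAddCommGroup G] [NormedSpace ℂ G] {F : Y × ℂ → G} {F' : Y × ℂ → Y →L[ℂ] G}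
    {y₀ : Y} {r : ℝ} (hr : 0 ≤ r)
    (hF : ∀ w ∈ sphere (0 : ℂ) r, ∀ᶠ z in 𝓝 (y₀, w), ContinuousAt F z)
    (hF' : ∀ w ∈ sphere (0 : ℂ) r, ContinuousAt F' (y₀, w))
    (hd : ∀ w ∈ sphere (0 : ℂ) r, ∀ᶠ z in 𝓝 (y₀, w),
      HasFDerivAt (fun y => F (y, z.2)) (F' z) z.1) :
    HasFDerivAt (fun y => ∮ w in C(0, r), F (y, w)) (∮ w in C(0, r), F' (y₀, w)) y₀ := by
  have hev : ∀ᶠ y in 𝓝 y₀, ∀ w ∈ sphere (0 : ℂ) r, ContinuousAt F (y, w) :=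
    (isCompact_sphere 0 r).eventually_forall_of_forall_eventually
      (P := fun y w => ContinuousAt F (y, w)) hF
  have hdev : ∀ᶠ y in 𝓝 y₀, ∀ w ∈ sphere (0 : ℂ) r,
      HasFDerivAt (fun y => F (y, w)) (F' (y, w)) y :=
    (isCompact_sphere 0 r).eventually_forall_of_forall_eventually
      (P := fun y w => HasFDerivAt (fun y => F (y, w)) (F' (y, w)) y) hd
  obtain ⟨C, hC⟩ := (isCompact_sphere (0 : ℂ) r).exists_eventually_norm_le hF'
  unfold circleIntegral
  refine intervalIntegral.hasFDerivAt_integral_of_dominated_of_fderiv_le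
    (s := {y | (∀ w ∈ sphere (0 : ℂ) r, ‖F' (y, w)‖ ≤ C) ∧
      ∀ w ∈ sphere (0 : ℂ) r, HasFDerivAt (fun y => F (y, w)) (F' (y, w)) y})
    (F' := fun y θ => deriv (circleMap 0 r) θ • F' (y, circleMap 0 r θ))
    (bound := fun _ => r * C) (hC.and hdev)
    (hev.mono fun y hy => (ContinuousAt.circleMap_slice hr hy).aestronglyMeasurable)
    (ContinuousAt.circleMap_slice hr hev.self_of_nhds |>.intervalIntegrable _ _)
    (ContinuousAt.circleMap_slice hr hF').aestronglyMeasurable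
    (.of_forall fun θ _ y hy => ?_) (by simp) (.of_forall fun θ _ y hy => ?_)
  · rw [norm_smul]
    have : ‖deriv (circleMap 0 r) θ‖ = r := by simp [deriv_circleMap, abs_of_nonneg hr]
    rw [this]
    exact mul_le_mul_of_nonneg_left (hy.1 _ (circleMap_mem_sphere 0 hr θ)) hr
  · exact (hy.2 _ (circleMap_mem_sphere 0 hr θ)).const_smul _

theorem contDiffAt_circleIntegral_nat {Y : Type} [NormedAddCommGroup Y] [NormedSpace ℂ Y]
    {r : ℝ} (hr : 0 ≤ r) (n : ℕ) : ∀ {G : Type} [NormedAddCommGroup G] [NormedSpace ℂ G]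
    {F : Y × ℂ → G} {y₀ : Y}, (∀ w ∈ sphere (0 : ℂ) r, ContDiffAt ℂ n F (y₀, w)) →
    ContDiffAt ℂ n (fun y => ∮ w in C(0, r), F (y, w)) y₀ := by
  have key : ∀ {n : ℕ} {G : Type} [NormedAddCommGroup G] [NormedSpace ℂ G]
      {F : Y × ℂ → G} {y₀ : Y}, (∀ w ∈ sphere (0 : ℂ) r, ContDiffAt ℂ n F (y₀, w)) →
      ∀ᶠ y in 𝓝 y₀, ∀ w ∈ sphere (0 : ℂ) r, ContDiffAt ℂ n F (y, w) := by
    intro n G _ _ F y₀ h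
    exact (isCompact_sphere 0 r).eventually_forall_of_forall_eventually
      (P := fun y w => ContDiffAt ℂ n F (y, w)) fun w hw => (h w hw).eventually (by simp)
  induction n with
  | zero =>
    intro G _ _ F y₀ h
    refine contDiffAt_zero.2 ⟨_, key h, fun y hy => ?_⟩
    refine (continuousAt_circleIntegral hr fun w hw => ?_).continuousWithinAt
    exact ((hy w hw).eventually (by simp)).mono fun z hz => hz.continuousAt
  | succ n ih =>
    intro G _ _ F y₀ h
    push_cast at h key ⊢
    have h1 : ∀ {y}, (∀ w ∈ sphere (0 : ℂ) r, ContDiffAt ℂ (n + 1) F (y, w)) →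
        ∀ w ∈ sphere (0 : ℂ) r, ContDiffAt ℂ n
          (fun z => (fderiv ℂ F z).comp (ContinuousLinearMap.inl ℂ Y ℂ)) (y, w) :=
      fun hy w hw => (hy w hw).fderiv_right_succ.clm_comp contDiffAt_const
    refine contDiffAt_succ_iff_hasFDerivAt.2 ⟨_, ⟨_, key (n := n + 1) (by simpa using h),
      fun y hy => ?_⟩, ih (h1 h)⟩
    have hy' : ∀ w ∈ sphere (0 : ℂ) r, ContDiffAt ℂ (n + 1) F (y, w) := by simpa using hy
    have hev : ∀ w ∈ sphere (0 : ℂ) r, ∀ᶠ z in 𝓝 (y, w), ContDiffAt ℂ (n + 1) F z :=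
      fun w hw => (hy' w hw).eventually (by exact_mod_cast ENat.natCast_ne_top (n + 1))
    refine hasFDerivAt_circleIntegral hr
      (fun w hw => (hev w hw).mono fun z hz => hz.continuousAt)
      (fun w hw => (h1 hy' w hw).continuousAt)
      (fun w hw => (hev w hw).mono fun z hz => ?_)
    have := (hz.differentiableAt (by simp)).hasFDerivAt
    exact this.comp (f := fun y => (y, z.2)) z.1 (hasFDerivAt_prodMk_left z.1 z.2)

theorem contDiffAt_circleIntegral {Y G : Type} [NormedAddCommGroup Y] [NormedSpace ℂ Y]
    [NormedAddCommGroup G] [NormedSpace ℂ G] {F : Y × ℂ → G} {y₀ : Y} {r : ℝ} (hr : 0 ≤ r)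
    (hF : ∀ w ∈ sphere (0 : ℂ) r, ContDiffAt ℂ ∞ F (y₀, w)) :
    ContDiffAt ℂ ∞ (fun y => ∮ w in C(0, r), F (y, w)) y₀ :=
  contDiffAt_infty.2 fun n =>
    contDiffAt_circleIntegral_nat hr n fun w hw => contDiffAt_infty.1 (hF w hw) n

theorem exists_radius_ne_zero {Y : Type} [NormedAddCommGroup Y] {p : Y × ℂ → ℂ}
    {Q : Y × ℂ → Prop}
    (hQ : ∀ᶠ z in 𝓝 (0 : Y × ℂ), Q z) (hp : ∀ᶠ z in 𝓝 (0 : Y × ℂ), ContinuousAt p z)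
    (h0 : ∀ᶠ w in 𝓝[≠] (0 : ℂ), p (0, w) ≠ 0) :
    ∃ r > 0, (∀ᶠ y in 𝓝 (0 : Y), ∀ w ∈ closedBall (0 : ℂ) r, Q (y, w)) ∧
      ∀ᶠ y in 𝓝 (0 : Y), ∀ w ∈ sphere (0 : ℂ) r, p (y, w) ≠ 0 := by
  obtain ⟨ε, hε, hball⟩ := Metric.eventually_nhds_iff.1 (hQ.and hp)
  obtain ⟨δ, hδ, hδ0⟩ := Metric.eventually_nhds_iff.1 (eventually_nhdsWithin_iff.1 h0)
  have hr : 0 < min ε δ / 2 := by positivity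
  have hrε : min ε δ / 2 < ε := by linarith [min_le_left ε δ]
  have hrδ : min ε δ / 2 < δ := by linarith [min_le_right ε δ]
  refine ⟨min ε δ / 2, hr, ?_, ?_⟩
  · filter_upwards [ball_mem_nhds (0 : Y) hε] with y hy w hw
    refine (hball ?_).1
    rw [Prod.dist_eq]
    exact max_lt hy ((mem_closedBall.1 hw).trans_lt hrε)
  · refine (isCompact_sphere 0 _).eventually_forall_of_forall_eventually
      (P := fun y w => p (y, w) ≠ 0) fun w hw => ?_
    rw [mem_sphere] at hw
    have hc : ContinuousAt p (0, w) := (hball (by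
      rw [Prod.dist_eq]
      exact max_lt (by simpa using hε) (hw.trans_lt hrε))).2
    refine hc.eventually_ne (hδ0 (hw.trans_lt hrδ) ?_)
    rintro rfl
    simp at hw
    exact hr.ne hw

section Projection

variable {Y : Type} [NormedAddCommGroup Y] [NormedSpace ℂ Y]

theorem analyticAt_slice {g : Y × ℂ → ℂ} {y : Y} {w : ℂ}
    (hg : ∀ᶠ z in 𝓝 (y, w), ContDiffAt ℂ ∞ g z) : AnalyticAt ℂ (fun w => g (y, w)) w := by
  rw [Complex.analyticAt_iff_eventually_differentiableAt]
  have : Tendsto (fun w : ℂ => (y, w)) (𝓝 w) (𝓝 (y, w)) :=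
    (by fun_prop : Continuous fun w : ℂ => (y, w)).tendsto w
  filter_upwards [this.eventually hg] with x hx
  exact (hx.differentiableAt (by simp)).comp x (by fun_prop)

theorem exists_eventually_ne_zero {N : ℕ} {φ : Fin N → ℂ → ℂ} (hφ : ∀ i, AnalyticAt ℂ (φ i) 0)
    (h : ∀ᶠ w in 𝓝[≠] (0 : ℂ), ∃ i, φ i w ≠ 0) : ∃ i, ∀ᶠ w in 𝓝[≠] (0 : ℂ), φ i w ≠ 0 := by
  by_contra! hcon
  have h0 : ∀ i, ∀ᶠ w in 𝓝[≠] (0 : ℂ), φ i w = 0 := fun i =>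
    (((hφ i).eventually_eq_zero_or_eventually_ne_zero).resolve_right (hcon i)).filter_mono
      nhdsWithin_le_nhds
  obtain ⟨w, ⟨i, hi⟩, hw⟩ := (h.and (eventually_all.2 h0)).exists
  exact hi (hw i)

theorem finite_zeros_slice {p : Y × ℂ → ℂ} (hp : ∀ᶠ z in 𝓝 (0 : Y × ℂ), ContDiffAt ℂ ∞ p z)
    (h0 : ∀ᶠ w in 𝓝[≠] (0 : ℂ), p (0, w) ≠ 0) :
    ∃ r > 0, ∀ᶠ y in 𝓝 (0 : Y), {w ∈ closedBall (0 : ℂ) r | p (y, w) = 0}.Finite := by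
  obtain ⟨r, hr, h1, h2⟩ := exists_radius_ne_zero (eventually_eventually_nhds.2 hp)
    (hp.mono fun z hz => hz.continuousAt) h0
  refine ⟨r, hr, ?_⟩
  filter_upwards [h1, h2] with y hy1 hy2
  exact AnalyticOnNhd.finite_zeros_closedBall_s1 (p := fun w => p (y, w)) hr
    (fun w hw => analyticAt_slice (hy1 w hw)) hy2

/-- The power sums of the values of `q (y, ·)` at the zeros of `p (y, ·)` in a disc. -/
noncomputable def rootPowerSum (p q : Y × ℂ → ℂ) (r : ℝ) (y : Y) (k : ℕ) : ℂ :=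
  (2 * π * Complex.I)⁻¹ * ∮ w in C(0, r), q (y, w) ^ k * (fderiv ℂ p (y, w) (0, 1) / p (y, w))

theorem contDiffAt_rootPowerSum {p q : Y × ℂ → ℂ} {r : ℝ} {y : Y} (hr : 0 ≤ r)
    (hp : ∀ w ∈ sphere (0 : ℂ) r, ContDiffAt ℂ ∞ p (y, w))
    (hq : ∀ w ∈ sphere (0 : ℂ) r, ContDiffAt ℂ ∞ q (y, w))
    (hp0 : ∀ w ∈ sphere (0 : ℂ) r, p (y, w) ≠ 0) (k : ℕ) :
    ContDiffAt ℂ ∞ (fun y => rootPowerSum p q r y k) y := by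
  refine contDiffAt_const.mul (contDiffAt_circleIntegral (F := fun z => q z ^ k *
    (fderiv ℂ p z (0, 1) / p z)) hr fun w hw => ?_)
  have h1 : ContDiffAt ℂ ∞ (fderiv ℂ p) (y, w) := (hp w hw).fderiv_right (by simp)
  exact ((hq w hw).pow k).mul ((h1.clm_apply contDiffAt_const).div (hp w hw) (hp0 w hw))

theorem exists_roots_rootPowerSum {p : Y × ℂ → ℂ} {r : ℝ} {y : Y} (hr : 0 < r)
    (hp : ∀ w ∈ closedBall (0 : ℂ) r, ∀ᶠ z in 𝓝 (y, w), ContDiffAt ℂ ∞ p z)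
    (hp0 : ∀ w ∈ sphere (0 : ℂ) r, p (y, w) ≠ 0) :
    ∃ (ι : Type) (_ : Fintype ι) (v : ι → ℂ),
      (∀ w, (∃ i, v i = w) ↔ w ∈ closedBall 0 r ∧ p (y, w) = 0) ∧
      ∀ q : Y × ℂ → ℂ,
        (∀ w ∈ closedBall (0 : ℂ) r, ∀ᶠ z in 𝓝 (y, w), ContDiffAt ℂ ∞ q z) →
        ∀ k, rootPowerSum p q r y k = ∑ i, q (y, v i) ^ k := by
  obtain ⟨ι, hι, v, hv, hsum⟩ := AnalyticOnNhd.exists_roots_circleIntegral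
    (p := fun w => p (y, w)) hr (fun w hw => analyticAt_slice (hp w hw)) hp0
  refine ⟨ι, hι, v, hv, fun q hq k => ?_⟩
  rw [← hsum (fun w => q (y, w) ^ k) fun w hw => (analyticAt_slice (hq w hw)).pow k, rootPowerSum]
  congr 1
  refine circleIntegral.integral_congr hr.le fun w hw => ?_
  have h1 := ((hp w (sphere_subset_closedBall hw)).self_of_nhds.differentiableAt
    (by simp)).hasFDerivAt
  have h2 := (h1.comp (f := fun w => (y, w)) w (hasFDerivAt_prodMk_right y w)).hasDerivAt.deriv
  simp only [Function.comp_def] at h2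
  simp [h2]

/-- If for many `τ` some member of a finite family of polynomials vanishes at `τ`, then some member
is zero. -/
theorem exists_forall_coeff_eq_zero {ι : Type} [Fintype ι] {N M : ℕ} (c : ι → Fin N → ℂ)
    (hM : Fintype.card ι * N < M)
    (h : ∀ t : Fin M, ∏ j, (∑ i : Fin N, (t : ℂ) ^ (i : ℕ) * c j i) = 0) :
    ∃ j, ∀ i, c j i = 0 := by
  set P : ι → Polynomial ℂ := fun j => ∑ i : Fin N, Polynomial.C (c j i) * Polynomial.X ^ (i : ℕ)
    with hP
  have hdeg : (∏ j, P j).natDegree < M := by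
    refine lt_of_le_of_lt ((Polynomial.natDegree_prod_le _ _).trans
      (Finset.sum_le_card_nsmul _ _ N fun j _ => ?_)) (by simpa using hM)
    refine Polynomial.natDegree_sum_le_of_forall_le _ _ fun i _ =>
      (Polynomial.natDegree_C_mul_X_pow_le _ _).trans i.2.le
  have hzero : ∏ j, P j = 0 := by
    refine Polynomial.eq_zero_of_natDegree_lt_card_of_eval_eq_zero _
      (f := fun t : Fin M => ((t : ℕ) : ℂ)) (fun a b hab => Fin.ext (Nat.cast_injective (R := ℂ) hab))
      (fun t => ?_) (by simpa using hdeg)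
    rw [Polynomial.eval_prod, ← h t]
    refine Finset.prod_congr rfl fun j _ => ?_
    simp only [hP, Polynomial.eval_finsetSum, Polynomial.eval_mul, Polynomial.eval_C,
      Polynomial.eval_pow, Polynomial.eval_X]
    exact Finset.sum_congr rfl fun i _ => mul_comm _ _
  obtain ⟨j, -, hj⟩ := Finset.prod_eq_zero_iff.1 hzero
  refine ⟨j, fun i => ?_⟩
  have := congrArg (fun Q => Polynomial.coeff Q (i : ℕ)) hj
  simpa [hP, Polynomial.finsetSum_coeff, Polynomial.coeff_C_mul, Polynomial.coeff_X_pow,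
    Fin.val_inj] using this

/-- Elimination of one variable: the projection of a common zero set which is isolated in the
central fibre is a common zero set. -/
theorem exists_elimination {N : ℕ} {g : Fin N → Y × ℂ → ℂ}
    (hg : ∀ i, ∀ᶠ z in 𝓝 (0 : Y × ℂ), ContDiffAt ℂ ∞ (g i) z)
    (hiso : ∀ᶠ w in 𝓝[≠] (0 : ℂ), ∃ i, g i (0, w) ≠ 0) {O : Set (Y × ℂ)} (hO : O ∈ 𝓝 0) :
    ∃ (M : ℕ) (h : Fin M → Y → ℂ), (∀ i, ∀ᶠ y in 𝓝 (0 : Y), ContDiffAt ℂ ∞ (h i) y) ∧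
      (∀ᶠ y in 𝓝 (0 : Y), (∀ i, h i y = 0) → ∃ w, (y, w) ∈ O ∧ ∀ i, g i (y, w) = 0) ∧
      ∀ᶠ z in 𝓝 (0 : Y × ℂ), (∀ i, g i z = 0) → ∀ i, h i z.1 = 0 := by
  obtain ⟨i₀, hi₀⟩ := exists_eventually_ne_zero (fun i => analyticAt_slice (hg i)) hiso
  set p := g i₀ with hp
  obtain ⟨r, hr, hQ, hne⟩ := exists_radius_ne_zero
    ((show ∀ᶠ z in 𝓝 0, z ∈ O from hO).and
      (eventually_all.2 fun i => eventually_eventually_nhds.2 (hg i)))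
    ((hg i₀).mono fun z hz => hz.continuousAt) hi₀
  let q : ℕ → Y × ℂ → ℂ := fun t z => ∑ i : Fin N, (t : ℂ) ^ (i : ℕ) * g i z
  have hq : ∀ {z}, (∀ i, ∀ᶠ x in 𝓝 z, ContDiffAt ℂ ∞ (g i) x) →
      ∀ t, ∀ᶠ x in 𝓝 z, ContDiffAt ℂ ∞ (q t) x := fun hz t =>
    (eventually_all.2 hz).mono fun x hx =>
      ContDiffAt.sum fun i _ => contDiffAt_const.mul (hx i)
  have hgood : ∀ᶠ y in 𝓝 (0 : Y), (∀ w ∈ closedBall (0 : ℂ) r, (y, w) ∈ O ∧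
      ∀ i, ∀ᶠ x in 𝓝 (y, w), ContDiffAt ℂ ∞ (g i) x) ∧ ∀ w ∈ sphere (0 : ℂ) r, p (y, w) ≠ 0 :=
    hQ.and hne
  have hsmooth : ∀ᶠ y in 𝓝 (0 : Y), ∀ t k, ContDiffAt ℂ ∞ (fun y => rootPowerSum p (q t) r y k) y :=
    hgood.mono fun y hy t => contDiffAt_rootPowerSum hr.le
      (fun w hw => ((hy.1 w (sphere_subset_closedBall hw)).2 i₀).self_of_nhds)
      (fun w hw => (hq (hy.1 w (sphere_subset_closedBall hw)).2 t).self_of_nhds) hy.2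
  have hroots : ∀ᶠ y in 𝓝 (0 : Y), ∃ (ι : Type) (_ : Fintype ι) (v : ι → ℂ),
      (∀ w, (∃ i, v i = w) ↔ w ∈ closedBall 0 r ∧ p (y, w) = 0) ∧
      ∀ t k, rootPowerSum p (q t) r y k = ∑ i, q t (y, v i) ^ k :=
    hgood.mono fun y hy => by
      obtain ⟨ι, hι, v, hv, hsum⟩ := exists_roots_rootPowerSum hr
        (fun w hw => (hy.1 w hw).2 i₀) hy.2
      exact ⟨ι, hι, v, hv, fun t => hsum (q t) fun w hw => hq (hy.1 w hw).2 t⟩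
  obtain ⟨ι₀, _, v₀, -, hsum₀⟩ := hroots.self_of_nhds
  obtain ⟨P, hP⟩ := exists_prod_eq_eval_psum (Fintype.card ι₀)
  have hcount : ∀ᶠ y in 𝓝 (0 : Y), ‖rootPowerSum p (q 0) r y 0 - Fintype.card ι₀‖ < 1 := by
    have hc := (hsmooth.self_of_nhds 0 0).continuousAt.sub
      (continuousAt_const (y := (Fintype.card ι₀ : ℂ)))
    refine hc.norm.eventually_lt_const ?_
    simp [hsum₀]
  let h : ℕ → Y → ℂ := fun t y => MvPolynomial.eval (rootPowerSum p (q t) r y) P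
  have hroots' : ∀ᶠ y in 𝓝 (0 : Y), ∃ (ι : Type) (_ : Fintype ι) (v : ι → ℂ),
      Fintype.card ι = Fintype.card ι₀ ∧
      (∀ w, (∃ i, v i = w) ↔ w ∈ closedBall 0 r ∧ p (y, w) = 0) ∧
      ∀ t, h t y = ∏ i, q t (y, v i) := by
    filter_upwards [hroots, hcount] with y ⟨ι, hι, v, hv, hsum⟩ hy
    have hcard : Fintype.card ι = Fintype.card ι₀ := by
      rw [hsum] at hy
      simp only [pow_zero, Finset.sum_const, Finset.card_univ, nsmul_eq_mul, mul_one] at hy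
      rw [show (Fintype.card ι : ℂ) - Fintype.card ι₀ =
        ((Fintype.card ι - Fintype.card ι₀ : ℤ) : ℂ) by push_cast; rfl, Complex.norm_intCast] at hy
      have : (Fintype.card ι - Fintype.card ι₀ : ℤ) = 0 :=
        Int.abs_lt_one_iff.1 (by exact_mod_cast hy)
      omega
    refine ⟨ι, hι, v, hcard, hv, fun t => ?_⟩
    rw [hP ι _ hcard]
    exact congrArg (fun s => MvPolynomial.eval s P) (funext (hsum t))
  refine ⟨Fintype.card ι₀ * N + 1, fun t => h t, fun t => ?_, ?_, ?_⟩
  · exact hsmooth.mono fun y hy => ContDiffAt.mvPolynomial_eval (hy t) P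
  · filter_upwards [hroots', hgood] with y ⟨ι, _, v, hcard, hv, hprod⟩ hy hzero
    obtain ⟨j, hj⟩ := exists_forall_coeff_eq_zero (fun j i => g i (y, v j))
      (M := Fintype.card ι₀ * N + 1) (by rw [hcard]; omega) fun t => by
        rw [← hzero t, hprod]
    exact ⟨v j, (hy.1 _ ((hv _).1 ⟨j, rfl⟩).1).1, hj⟩
  · have h1 : ∀ᶠ z in 𝓝 (0 : Y × ℂ), z.2 ∈ closedBall (0 : ℂ) r :=
      continuous_snd.tendsto (0 : Y × ℂ) (closedBall_mem_nhds _ hr)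
    have h2 := (continuous_fst.tendsto (0 : Y × ℂ)).eventually hroots'
    filter_upwards [h1, h2] with z hz ⟨ι, _, v, _, hv, hprod⟩ hzero t
    obtain ⟨j, hj⟩ := (hv z.2).2 ⟨hz, hzero i₀⟩
    rw [hprod]
    refine Finset.prod_eq_zero (Finset.mem_univ j) ?_
    simp [q, hj, hzero]

/-- Local finite mapping theorem: a common zero set that is isolated in the central fibre has an
image in the base which is a common zero set. -/
theorem exists_elimination_pi (m : ℕ) : ∀ {Y : Type} [NormedAddCommGroup Y] [NormedSpace ℂ Y]
    {N : ℕ} {g : Fin N → Y × (Fin m → ℂ) → ℂ}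
    (_ : ∀ i, ∀ᶠ z in 𝓝 (0 : Y × (Fin m → ℂ)), ContDiffAt ℂ ∞ (g i) z)
    (_ : ∀ᶠ w in 𝓝 (0 : Fin m → ℂ), (∀ i, g i (0, w) = 0) → w = 0)
    {O : Set (Y × (Fin m → ℂ))} (_ : O ∈ 𝓝 0),
    ∃ (M : ℕ) (h : Fin M → Y → ℂ), (∀ i, ∀ᶠ y in 𝓝 (0 : Y), ContDiffAt ℂ ∞ (h i) y) ∧
      (∀ᶠ y in 𝓝 (0 : Y), (∀ i, h i y = 0) → ∃ w, (y, w) ∈ O ∧ ∀ i, g i (y, w) = 0) ∧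
      ∀ᶠ z in 𝓝 (0 : Y × (Fin m → ℂ)), (∀ i, g i z = 0) → ∀ i, h i z.1 = 0 := by
  induction m with
  | zero =>
    intro Y _ _ N g hg _ O hO
    have ht : Tendsto (fun y : Y => (y, (0 : Fin 0 → ℂ))) (𝓝 0) (𝓝 0) :=
      (by fun_prop : Continuous fun y : Y => (y, (0 : Fin 0 → ℂ))).tendsto 0
    refine ⟨N, fun i y => g i (y, 0), fun i => ?_, ?_, .of_forall fun z hz i => ?_⟩
    · exact (ht.eventually (hg i)).mono fun y hy => hy.comp y (by fun_prop)
    · exact (ht.eventually hO).mono fun y hy h0 => ⟨0, hy, h0⟩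
    · rw [← hz i, Subsingleton.elim 0 z.2]
  | succ m ih =>
    intro Y _ _ N g hg hiso O hO
    let L : (Y × (Fin m → ℂ)) × ℂ → Y × (Fin (m + 1) → ℂ) := fun z => (z.1.1, Fin.cons z.2 z.1.2)
    have hL : ContDiff ℂ ∞ L := by
      refine contDiff_fst.fst.prodMk (contDiff_pi.2 fun i => ?_)
      refine Fin.cases ?_ (fun j => ?_) i
      · simpa using contDiff_snd
      · simp only [Fin.cons_succ]
        fun_prop
    have hL0 : L 0 = 0 := by
      refine Prod.ext rfl (funext fun i => ?_)
      exact Fin.cases rfl (fun j => rfl) i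
    have ht : Tendsto L (𝓝 0) (𝓝 0) := hL0 ▸ hL.continuous.tendsto 0
    let R : Y × (Fin (m + 1) → ℂ) → (Y × (Fin m → ℂ)) × ℂ := fun z => ((z.1, Fin.tail z.2), z.2 0)
    have hRc : Continuous R := by
      refine (continuous_fst.prodMk (continuous_pi fun i => ?_)).prodMk (by fun_prop)
      simp only [Fin.tail]
      fun_prop
    have hLR : ∀ z, L (R z) = z := fun z => Prod.ext rfl (Fin.cons_self_tail z.2)
    have htR : Tendsto R (𝓝 0) (𝓝 0) := hRc.tendsto 0
    have hisoz : ∀ᶠ z in 𝓝 (0 : Y × (Fin (m + 1) → ℂ)), (∀ i, g i (0, z.2) = 0) → z.2 = 0 :=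
      (continuous_snd.tendsto (0 : Y × (Fin (m + 1) → ℂ))).eventually hiso
    have hg' : ∀ i, ∀ᶠ z in 𝓝 0, ContDiffAt ℂ ∞ (g i ∘ L) z := fun i =>
      (ht.eventually (hg i)).mono fun z hz => hz.comp z hL.contDiffAt
    obtain ⟨M₁, h₁, hs₁, hex₁, hz₁⟩ := exists_elimination hg' (by
      have hc : Tendsto (fun w : ℂ => ((0 : Y × (Fin m → ℂ)), w)) (𝓝 0) (𝓝 0) :=
        (by fun_prop : Continuous fun w : ℂ => ((0 : Y × (Fin m → ℂ)), w)).tendsto 0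
      filter_upwards [nhdsWithin_le_nhds ((ht.comp hc).eventually hisoz), self_mem_nhdsWithin]
        with w hw hw0
      by_contra! hcon
      exact hw0 (congrFun (hw hcon) 0)) (ht.eventually (hisoz.and hO))
    obtain ⟨M, h, hs, hex, hz⟩ := ih hs₁ (by
      have hc : Tendsto (fun w : Fin m → ℂ => ((0 : Y), w)) (𝓝 0) (𝓝 0) :=
        (by fun_prop : Continuous fun w : Fin m → ℂ => ((0 : Y), w)).tendsto 0
      filter_upwards [hc.eventually hex₁] with w hw h0
      obtain ⟨x, hx, hgx⟩ := hw h0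
      have := hx.1 hgx
      exact funext fun i => congrFun this i.succ) hex₁
    refine ⟨M, h, hs, ?_, ?_⟩
    · filter_upwards [hex] with y hy h0
      obtain ⟨w', hw', hzero⟩ := hy h0
      obtain ⟨x, hx, hgx⟩ := hw' hzero
      exact ⟨_, hx.2, hgx⟩
    · have hf : Tendsto (fun z => (R z).1) (𝓝 0) (𝓝 0) := (continuous_fst.comp hRc).tendsto 0
      filter_upwards [htR.eventually hz₁, hf.eventually hz] with z h1 h2 h0
      exact h2 (h1 fun i => by simpa [hLR] using h0 i)

/-- Each fibre coordinate of a common zero set isolated in the central fibre satisfies an equation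
over the base. -/
theorem exists_finite_coordinate {m N : ℕ} {g : Fin N → Y × (Fin m → ℂ) → ℂ}
    (hg : ∀ i, ∀ᶠ z in 𝓝 (0 : Y × (Fin m → ℂ)), ContDiffAt ℂ ∞ (g i) z)
    (hiso : ∀ᶠ w in 𝓝 (0 : Fin m → ℂ), (∀ i, g i (0, w) = 0) → w = 0) (j : Fin m) :
    ∃ F : Y → Set ℂ, (∀ᶠ y in 𝓝 (0 : Y), (F y).Finite) ∧
      ∀ᶠ z in 𝓝 (0 : Y × (Fin m → ℂ)), (∀ i, g i z = 0) → z.2 j ∈ F z.1 := by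
  let G : Fin (N + 1) → (Y × ℂ) × (Fin m → ℂ) → ℂ :=
    Fin.cons (fun z => z.1.2 - z.2 j) fun i z => g i (z.1.1, z.2)
  have hπ : Tendsto (fun z : (Y × ℂ) × (Fin m → ℂ) => (z.1.1, z.2)) (𝓝 0) (𝓝 0) :=
    (by fun_prop : Continuous fun z : (Y × ℂ) × (Fin m → ℂ) => (z.1.1, z.2)).tendsto 0
  have hG : ∀ i, ∀ᶠ z in 𝓝 0, ContDiffAt ℂ ∞ (G i) z := by
    refine Fin.cases (.of_forall fun z => ?_) fun i => ?_
    · simp only [G, Fin.cons_zero]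
      fun_prop
    · exact (hπ.eventually (hg i)).mono fun z hz =>
        hz.comp (f := fun z : (Y × ℂ) × (Fin m → ℂ) => (z.1.1, z.2)) z (by fun_prop)
  have hisoz : ∀ᶠ z in 𝓝 (0 : (Y × ℂ) × (Fin m → ℂ)), (∀ i, g i (0, z.2) = 0) → z.2 = 0 :=
    (continuous_snd.tendsto (0 : (Y × ℂ) × (Fin m → ℂ))).eventually hiso
  obtain ⟨M, h, hs, hex, hz⟩ := exists_elimination_pi m hG
    (hiso.mono fun w hw h0 => hw fun i => h0 i.succ) hisoz
  have hc : Tendsto (fun w : ℂ => ((0 : Y), w)) (𝓝 0) (𝓝 0) :=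
    (by fun_prop : Continuous fun w : ℂ => ((0 : Y), w)).tendsto 0
  obtain ⟨i, hi⟩ := exists_eventually_ne_zero (fun i => analyticAt_slice (hs i)) (by
    filter_upwards [nhdsWithin_le_nhds (hc.eventually hex), self_mem_nhdsWithin] with t ht ht0
    by_contra! hcon
    obtain ⟨w, hw, hGw⟩ := ht hcon
    have hw0 : w = 0 := hw fun i => hGw i.succ
    have := hGw 0
    simp only [G, Fin.cons_zero, hw0, Pi.zero_apply, sub_zero] at this
    exact ht0 this)
  obtain ⟨r, hr, hfin⟩ := finite_zeros_slice (hs i) hi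
  refine ⟨_, hfin, ?_⟩
  have hγ : Tendsto (fun z : Y × (Fin m → ℂ) => ((z.1, z.2 j), z.2)) (𝓝 0) (𝓝 0) :=
    (by fun_prop : Continuous fun z : Y × (Fin m → ℂ) => ((z.1, z.2 j), z.2)).tendsto 0
  have hball : ∀ᶠ z in 𝓝 (0 : Y × (Fin m → ℂ)), z.2 j ∈ closedBall (0 : ℂ) r :=
    (by fun_prop : Continuous fun z : Y × (Fin m → ℂ) => z.2 j).tendsto 0
      (closedBall_mem_nhds _ hr)
  filter_upwards [hγ.eventually hz, hball] with z h1 h2 h0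
  exact ⟨h2, h1 (Fin.cases (by simp [G]) h0) i⟩

end Projection

/- STATEMENT 1: central isolation implies that, on a fixed open neighborhood W ⊆ U
of 0, every slice function f_a (a ∈ ℂ^s) has only finitely many critical points
in W. -/
theorem stmt_1 (n s : ℕ) (hn : 1 ≤ n) (hs : s ≤ n)
    (U : Set (Csp n s)) (hU : IsOpen U) (h0U : (0 : Csp n s) ∈ U)
    (f : Csp n s → ℂ) (hf : ∀ z ∈ U, AnalyticAt ℂ f z)
    (hiso : CentralIsolation n s f U) :
    ∃ W : Set (Csp n s), IsOpen W ∧ (0 : Csp n s) ∈ W ∧ W ⊆ U ∧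
      ∀ a : Fin s → ℂ,
        {z ∈ W | z.1 = a ∧ PartialsVanish n s f z}.Finite := by
  let g : Fin (n + 1 - s) → Csp n s → ℂ := fun j z => fderiv ℂ f z (0, Pi.single j 1)
  have hg : ∀ j, ∀ᶠ z in 𝓝 (0 : Csp n s), ContDiffAt ℂ ∞ (g j) z := fun j => by
    filter_upwards [hU.mem_nhds h0U] with z hz
    exact (hf z hz).fderiv.contDiffAt.clm_apply contDiffAt_const
  have hiso' : ∀ᶠ w in 𝓝 (0 : Fin (n + 1 - s) → ℂ), (∀ j, g j (0, w) = 0) → w = 0 := by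
    obtain ⟨W, hW, h0W, hWiso⟩ := hiso
    have hc : Tendsto (fun w : Fin (n + 1 - s) → ℂ => ((0 : Fin s → ℂ), w)) (𝓝 0) (𝓝 0) :=
      (by fun_prop : Continuous fun w : Fin (n + 1 - s) → ℂ => ((0 : Fin s → ℂ), w)).tendsto 0
    filter_upwards [hc.eventually ((hU.inter hW).mem_nhds ⟨h0U, h0W⟩)] with w hw h0
    exact congrArg Prod.snd (hWiso _ hw rfl h0)
  choose F hF hzF using exists_finite_coordinate hg hiso'
  have hF' := (continuous_fst.tendsto (0 : Csp n s)).eventually (eventually_all.2 hF)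
  obtain ⟨W, hWsub, hW, h0W⟩ := _root_.eventually_nhds_iff.1
    ((eventually_all.2 hzF).and (hF'.and (hU.mem_nhds h0U)))
  refine ⟨W, hW, h0W, fun z hz => (hWsub z hz).2.2, fun a => ?_⟩
  rcases Set.eq_empty_or_nonempty {z ∈ W | z.1 = a ∧ PartialsVanish n s f z} with he | ⟨z₀, hz₀⟩
  · rw [he]
    exact Set.finite_empty
  have hfin : ∀ j, (F j a).Finite := fun j => by
    have := (hWsub z₀ hz₀.1).2.1 j
    rwa [hz₀.2.1] at this
  refine ((Set.finite_singleton a).prod (Set.Finite.pi' hfin)).subset ?_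
  rintro z ⟨hzW, rfl, hz⟩
  exact ⟨rfl, fun j => (hWsub z hzW).1 j hz⟩
end

section
/- Suppose 0 ∈ Σf, suppose Σf is a graph over ℂ^s near 0 (there exist an open neighborhood W ⊆ U of 0, a connected open set V' ⊆ ℂ^s containing 0, and a complex analytic map φ : V' → ℂ^{n+1−s} with φ(0) = 0 such that Σf ∩ W = {(a, φ(a)) : a ∈ V'}), and suppose f satisfies the a_f condition near 0 (there is an open neighborhood W₁ ⊆ U of 0 such that for every p ∈ Σf ∩ W₁, every sequence (q_k) in W₁ ∖ Σf with q_k → p, and every continuous ℂ-linear functional η on ℂ^{n+1} with Df(q_k)/‖Df(q_k)‖ → η in operator norm, η vanishes on the tangent cone over ℝ of Σf at p). Then f satisfies the Jacobian set equality near 0: there is an open neighborhood W' ⊆ U of 0 such that Σf ∩ W' = {z ∈ W' : ∂f/∂z_j(z) = 0 for all s ≤ j ≤ n}; moreover f satisfies central isolation: 0 is an isolated point of {z ∈ U : z_0 = ⋯ = z_{s−1} = 0 and ∂f/∂z_j(z) = 0 for all s ≤ j ≤ n}. -/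
/-- The critical locus Σf = {z ∈ U : Df(z) = 0}. -/
def SigmaF (n s : ℕ) (f : Csp n s → ℂ) (U : Set (Csp n s)) : Set (Csp n s) :=
  {z ∈ U | fderiv ℂ f z = 0}

/-- Jacobian set equality near 0: on some open neighborhood W' ⊆ U of 0,
Σf ∩ W' = {z ∈ W' : ∂f/∂z_j(z) = 0 for all s ≤ j ≤ n}. -/
def JacobianEq (n s : ℕ) (f : Csp n s → ℂ) (U : Set (Csp n s)) : Prop :=
  ∃ W' : Set (Csp n s), IsOpen W' ∧ (0 : Csp n s) ∈ W' ∧ W' ⊆ U ∧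
    SigmaF n s f U ∩ W' = {z ∈ W' | PartialsVanish n s f z}

/-- Σf is, near 0, a graph over a connected open subset of ℂ^s via an analytic map
φ with φ(0) = 0. -/
def GraphForm (n s : ℕ) (f : Csp n s → ℂ) (U : Set (Csp n s)) : Prop :=
  ∃ (W : Set (Csp n s)) (V' : Set (Fin s → ℂ))
    (φ : (Fin s → ℂ) → (Fin (n + 1 - s) → ℂ)),
    IsOpen W ∧ (0 : Csp n s) ∈ W ∧ W ⊆ U ∧
    IsOpen V' ∧ IsConnected V' ∧ (0 : Fin s → ℂ) ∈ V' ∧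
    AnalyticOnNhd ℂ φ V' ∧ φ 0 = 0 ∧
    SigmaF n s f U ∩ W = (fun a => (a, φ a)) '' V'

/-- The a_f (Thom) condition near 0: on an open neighborhood W₁ ⊆ U of 0, every
limit η of normalized differentials Df(q_k)/‖Df(q_k)‖ along non-critical points
q_k → p ∈ Σf kills the tangent cone (over ℝ) of Σf at p. -/
def AfCondition (n s : ℕ) (f : Csp n s → ℂ) (U : Set (Csp n s)) : Prop :=
  ∃ W₁ : Set (Csp n s), IsOpen W₁ ∧ (0 : Csp n s) ∈ W₁ ∧ W₁ ⊆ U ∧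
    ∀ p ∈ SigmaF n s f U ∩ W₁, ∀ q : ℕ → Csp n s,
      (∀ k, q k ∈ W₁ ∧ q k ∉ SigmaF n s f U) →
      Filter.Tendsto q Filter.atTop (nhds p) →
      ∀ η : Csp n s →L[ℂ] ℂ,
        Filter.Tendsto (fun k => (‖fderiv ℂ f (q k)‖)⁻¹ • fderiv ℂ f (q k))
          Filter.atTop (nhds η) →
        ∀ v ∈ tangentConeAt ℝ (SigmaF n s f U) p, η v = 0

/-- The tangent cone at `(x, φ x)` of a set containing the graph of `φ` near `x` contains
the graph of the derivative of `φ` at `x`. -/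
theorem mem_tangentConeAt_of_graph_subset {E F : Type*} [NormedAddCommGroup E]
    [NormedSpace ℝ E] [NormedAddCommGroup F] [NormedSpace ℝ F] {φ : E → F}
    {φ' : E →L[ℝ] F} {x : E} {V : Set E} {S : Set (E × F)} (hV : V ∈ nhds x)
    (hφ : HasFDerivAt φ φ' x) (hS : (fun a => (a, φ a)) '' V ⊆ S) (a : E) :
    (a, φ' a) ∈ tangentConeAt ℝ S (x, φ x) := by
  have h : HasFDerivWithinAt (fun a => (a, φ a)) ((ContinuousLinearMap.id ℝ E).prod φ') V x :=
    ((hasFDerivAt_id x).prodMk hφ).hasFDerivWithinAt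
  have ha : a ∈ tangentConeAt ℝ V x := by
    rw [tangentConeAt_of_mem_nhds hV]
    exact Set.mem_univ a
  exact tangentConeAt_mono hS (h.mapsTo_tangent_cone ha)

/-- A continuous linear functional on a finite-dimensional product vanishing on `0 × ℂ^m` and
on the graph of a map is zero. -/
theorem eq_zero_of_forall_graph_of_forall_single {E : Type*} [NormedAddCommGroup E]
    [NormedSpace ℂ E] {m : ℕ} (η : E × (Fin m → ℂ) →L[ℂ] ℂ) (L : E → Fin m → ℂ)
    (hL : ∀ a, η (a, L a) = 0) (hη : ∀ j, η (0, Pi.single j 1) = 0) : η = 0 := by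
  have hsnd : ∀ w, η (0, w) = 0 := by
    have : (η.comp (ContinuousLinearMap.inr ℂ E (Fin m → ℂ))).toLinearMap = 0 := by
      refine (Pi.basisFun ℂ (Fin m)).ext fun j => ?_
      simpa using hη j
    intro w
    simpa using LinearMap.congr_fun this w
  refine ContinuousLinearMap.ext fun ⟨a, w⟩ => ?_
  have : (a, w) = (a, L a) + (0, w - L a) := by simp
  rw [this, map_add, hL, hsnd]
  simp

/-- Near the origin, the vanishing of the partial derivatives transverse to the graph forces
the whole differential to vanish. -/
theorem eventually_mem_sigmaF_of_partialsVanish {n s : ℕ} {U : Set (Csp n s)}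
    {f : Csp n s → ℂ} (h0crit : (0 : Csp n s) ∈ SigmaF n s f U)
    (hgraph : GraphForm n s f U) (haf : AfCondition n s f U) :
    ∀ᶠ z in nhds (0 : Csp n s), PartialsVanish n s f z → z ∈ SigmaF n s f U := by
  obtain ⟨W, V, φ, -, -, -, hV, -, h0V, hφ, hφ0, hW⟩ := hgraph
  obtain ⟨W₁, hW₁, h0W₁, hW₁U, haf⟩ := haf
  by_contra hne
  have hfreq := (Filter.not_eventually.mp hne).and_eventually (hW₁.mem_nhds h0W₁)
  obtain ⟨q, hq, hqP⟩ := Filter.exists_seq_forall_of_frequently hfreq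
  have hnz : ∀ k, fderiv ℂ f (q k) ≠ 0 := fun k h =>
    (hqP k).1 fun _ => ⟨hW₁U (hqP k).2, h⟩
  have hunit : ∀ k, (‖fderiv ℂ f (q k)‖)⁻¹ • fderiv ℂ f (q k) ∈
      Metric.sphere (0 : Csp n s →L[ℂ] ℂ) 1 := fun k => by
    rw [mem_sphere_zero_iff_norm, norm_smul, norm_inv, norm_norm,
      inv_mul_cancel₀ (norm_ne_zero_iff.mpr (hnz k))]
  have : ProperSpace (Csp n s →L[ℂ] ℂ) := FiniteDimensional.proper ℂ _
  obtain ⟨η, hη, r, hr, hlim⟩ := (isCompact_sphere (0 : Csp n s →L[ℂ] ℂ) 1).tendsto_subseq hunit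
  have hcone : ∀ v ∈ tangentConeAt ℝ (SigmaF n s f U) (0 : Csp n s), η v = 0 :=
    haf 0 ⟨h0crit, h0W₁⟩ (q ∘ r)
      (fun k => ⟨(hqP (r k)).2, fun h => (hqP (r k)).1 fun _ => h⟩)
      (hq.comp hr.tendsto_atTop) η hlim
  have hpart : ∀ j, η (0, Pi.single j 1) = 0 := fun j => by
    have hev := ((ContinuousLinearMap.apply ℂ ℂ
      ((0, Pi.single j 1) : Csp n s)).continuous.tendsto η).comp hlim
    refine tendsto_nhds_unique hev (tendsto_const_nhds.congr fun k => ?_)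
    have hpv : PartialsVanish n s f (q (r k)) := (Classical.not_imp.mp (hqP (r k)).1).1
    simp [hpv j]
  have hdφ := (hφ 0 h0V).differentiableAt.hasFDerivAt.restrictScalars ℝ
  have hgr : ∀ a, η (a, fderiv ℂ φ 0 a) = 0 := fun a => by
    have := mem_tangentConeAt_of_graph_subset (hV.mem_nhds h0V) hdφ
      (hW.symm.subset.trans Set.inter_subset_left) a
    rw [hφ0] at this
    exact hcone _ this
  have := eq_zero_of_forall_graph_of_forall_single η _ hgr hpart
  simp [this] at hη

/- STATEMENT 4: if Σf is a graph over ℂ^s near 0 and f satisfies the a_f condition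
near 0, then f satisfies the Jacobian set equality near 0 and central isolation. -/
theorem stmt_4 (n s : ℕ) (hn : 1 ≤ n) (hs : s ≤ n)
    (U : Set (Csp n s)) (hU : IsOpen U) (h0U : (0 : Csp n s) ∈ U)
    (f : Csp n s → ℂ) (hf : ∀ z ∈ U, AnalyticAt ℂ f z)
    (h0crit : (0 : Csp n s) ∈ SigmaF n s f U)
    (hgraph : GraphForm n s f U)
    (haf : AfCondition n s f U) :
    JacobianEq n s f U ∧ CentralIsolation n s f U := by
  obtain ⟨W', hW'sub, hW', h0W'⟩ := mem_nhds_iff.mp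
    ((eventually_mem_sigmaF_of_partialsVanish h0crit hgraph haf).and (hU.mem_nhds h0U))
  refine ⟨⟨W', hW', h0W', fun z hz => (hW'sub hz).2, ?_⟩, ?_⟩
  · ext z
    refine ⟨fun hz => ⟨hz.2, fun j => ?_⟩, fun hz => ⟨(hW'sub hz.1).1 hz.2, hz.1⟩⟩
    rw [hz.1.2]
    rfl
  · obtain ⟨W, V, φ, hW, h0W, -, -, -, -, -, hφ0, hgr⟩ := hgraph
    refine ⟨W' ∩ W, hW'.inter hW, ⟨h0W', h0W⟩, fun z hz hz1 hpv => ?_⟩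
    have hmem : z ∈ SigmaF n s f U ∩ W := ⟨(hW'sub hz.2.1).1 hpv, hz.2.2⟩
    rw [hgr] at hmem
    obtain ⟨a, -, rfl⟩ := hmem
    obtain rfl : a = 0 := hz1
    simp [hφ0]
end
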